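/- For every integer n ≥ 5, every planar simple graph G on n vertices that contains no subgraph isomorphic to the Theta graph on 5 vertices (a 5-cycle plus a chord) satisfies e(G) ≤ 5(n−2)/2. In particular, ex_P(n, Θ₅) ≤ 5(n−2)/2 for all n ≥ 5. -/

import Mathlib

open SimpleGraph

/-- `G` has a planar embedding (drawing in the plane): vertices are mapped to distinct
points of `ℝ²`, each edge `uv` is drawn as a simple continuous arc from the point of `u`
to the point of `v`, arcs traversed in opposite directions coincide, the interior of an
arc passes through no vertex point, and the interiors of arcs of distinct edges are
disjoint. -/
def SimpleGraph.HasPlanarEmbedding {V : Type*} (G : SimpleGraph V) : Prop :=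
  ∃ (pos : V → ℝ × ℝ) (arc : V → V → ℝ → ℝ × ℝ),
    Function.Injective pos ∧
    (∀ u v : V, G.Adj u v →
      ContinuousOn (arc u v) (Set.Icc (0 : ℝ) 1) ∧
      Set.InjOn (arc u v) (Set.Icc (0 : ℝ) 1) ∧
      arc u v 0 = pos u ∧
      arc u v 1 = pos v ∧
      (∀ t : ℝ, arc u v t = arc v u (1 - t)) ∧
      (∀ w : V, ∀ t ∈ Set.Ioo (0 : ℝ) 1, arc u v t ≠ pos w)) ∧
    (∀ u v x y : V, G.Adj u v → G.Adj x y → s(u, v) ≠ s(x, y) →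
      ∀ t₁ ∈ Set.Ioo (0 : ℝ) 1, ∀ t₂ ∈ Set.Ioo (0 : ℝ) 1, arc u v t₁ ≠ arc x y t₂)

/-- `G` contains a subgraph isomorphic to `F`, i.e. there is an injective graph
homomorphism from `F` to `G`. -/
def ContainsCopy {α β : Type*} (F : SimpleGraph α) (G : SimpleGraph β) : Prop :=
  ∃ f : F →g G, Function.Injective f

/-- The Theta graph on 4 vertices: the 4-cycle 0-1-2-3-0 plus the chord 02,
i.e. `K₄` minus one edge. -/
def theta4 : SimpleGraph (Fin 4) :=
  SimpleGraph.fromEdgeSet {s(0, 1), s(1, 2), s(2, 3), s(0, 3), s(0, 2)}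

/-- The Theta graph on 5 vertices: the 5-cycle 0-1-2-3-4-0 plus the chord 02. -/
def theta5 : SimpleGraph (Fin 5) :=
  SimpleGraph.fromEdgeSet {s(0, 1), s(1, 2), s(2, 3), s(3, 4), s(0, 4), s(0, 2)}

/-- The cycle on 6 vertices: 0-1-2-3-4-5-0. -/
def cycle6 : SimpleGraph (Fin 6) :=
  SimpleGraph.fromEdgeSet {s(0, 1), s(1, 2), s(2, 3), s(3, 4), s(4, 5), s(0, 5)}

/-- `G` contains no member of `Θ₆` as a subgraph: for each pair of distinct
non-consecutive vertices `a`, `b` of the 6-cycle, `G` contains no copy of the Theta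
graph obtained from the 6-cycle by adding the chord `ab`. -/
def Theta6Free {β : Type*} (G : SimpleGraph β) : Prop :=
  ∀ a b : Fin 6, a ≠ b → ¬ cycle6.Adj a b →
    ¬ ContainsCopy (cycle6 ⊔ SimpleGraph.fromEdgeSet {s(a, b)}) G

/-- `K₅⁻`: the complete graph on 5 vertices minus one edge. -/
def K5minus : SimpleGraph (Fin 5) :=
  (⊤ : SimpleGraph (Fin 5)).deleteEdges {s(0, 1)}

/-- `f` has a continuous logarithm on `S`. -/
def HasLogOn (f : ℂ → ℂ) (S : Set ℂ) : Prop :=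
  ∃ h : ℂ → ℂ, ContinuousOn h S ∧ ∀ z ∈ S, Complex.exp (h z) = f z

theorem constant_of_int_multiples {X : Type*} [TopologicalSpace X] [PreconnectedSpace X] {φ : X → ℂ}
    (hφ : Continuous φ) (hinteger : ∀ x, ∃ n : ℤ, φ x = n * (2 * Real.pi * Complex.I)) (x y : X) :
    φ x = φ y := by
  choose n hn using hinteger
  have hr : Continuous fun x => (φ x / (2 * Real.pi * Complex.I)).re :=
    Complex.continuous_re.comp (hφ.div_const _)
  have hn' : Continuous n := by
    rw [Int.isClosedEmbedding_coe_real.isEmbedding.continuous_iff]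
    convert! hr using 2 with x
    simp [hn]
  rw [hn, hn, PreconnectedSpace.constant inferInstance hn' (x := x) (y := y)]

/-- Two continuous logarithms of the same function differ by a constant along paths. -/
theorem JoinedIn.sub_eq_of_exp_eq {S : Set ℂ} {a b : ℂ} (hab : JoinedIn S a b) {h k : ℂ → ℂ}
    (hc : ContinuousOn h S) (kc : ContinuousOn k S)
    (he : ∀ z ∈ S, Complex.exp (h z) = Complex.exp (k z)) : h a - k a = h b - k b := by
  obtain ⟨γ, hγ⟩ := hab
  have h1 : Continuous fun t => h (γ t) - k (γ t) :=
    (hc.comp_continuous (by fun_prop) hγ).sub (kc.comp_continuous (by fun_prop) hγ)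
  have := constant_of_int_multiples h1 (fun t => by
    obtain ⟨n, hn⟩ := Complex.exp_eq_exp_iff_exists_int.1 (he _ (hγ t))
    exact ⟨n, by rw [hn]; ring⟩) 0 1
  simpa using this

namespace HasLogOn

variable {f g : ℂ → ℂ} {S T : Set ℂ}

theorem mono (hf : HasLogOn f T) (hST : S ⊆ T) : HasLogOn f S :=
  let ⟨h, hc, he⟩ := hf
  ⟨h, hc.mono hST, fun z hz => he z (hST hz)⟩

theorem congr (hf : HasLogOn f S) (hfg : ∀ z ∈ S, f z = g z) : HasLogOn g S :=
  let ⟨h, hc, he⟩ := hf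
  ⟨h, hc, fun z hz => (he z hz).trans (hfg z hz)⟩

theorem mul (hf : HasLogOn f S) (hg : HasLogOn g S) : HasLogOn (fun z => f z * g z) S :=
  let ⟨h, hc, he⟩ := hf
  let ⟨k, kc, ke⟩ := hg
  ⟨fun z => h z + k z, hc.add kc, fun z hz => by rw [Complex.exp_add, he z hz, ke z hz]⟩

theorem zpow (hf : HasLogOn f S) (m : ℤ) : HasLogOn (fun z => f z ^ m) S :=
  let ⟨h, hc, he⟩ := hf
  ⟨fun z => m * h z, continuousOn_const.mul hc, fun z hz => by rw [Complex.exp_int_mul, he z hz]⟩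

theorem inv (hf : HasLogOn f S) : HasLogOn (fun z => (f z)⁻¹) S :=
  let ⟨h, hc, he⟩ := hf
  ⟨fun z => -h z, hc.neg, fun z hz => by rw [Complex.exp_neg, he z hz]⟩

theorem of_norm_sub_one_lt (hf : ContinuousOn f S) (h1 : ∀ z ∈ S, ‖f z - 1‖ < 1) :
    HasLogOn f S := by
  have hslit : ∀ z ∈ S, f z ∈ Complex.slitPlane := fun z hz => by
    have := Complex.mem_slitPlane_of_norm_lt_one (h1 z hz)
    simpa using this
  exact ⟨fun z => Complex.log (f z), hf.clog hslit, fun z hz =>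
    Complex.exp_log (Complex.slitPlane_ne_zero (hslit z hz))⟩

theorem of_sphere_zpow {a : ℂ} {R : ℝ} (hR : 0 < R) {m : ℤ}
    (h : HasLogOn (fun z => (z - a) ^ m) (Metric.sphere a R)) : m = 0 := by
  obtain ⟨k, kc, ke⟩ := h
  set c : ℝ → ℂ := fun θ => a + R * Complex.exp (θ * Complex.I) with hc
  have hcs : ∀ θ, c θ ∈ Metric.sphere a R := fun θ => by
    simp [hc, Complex.norm_exp_ofReal_mul_I, abs_of_pos hR]
  have hcc : Continuous c := by fun_prop
  have hkc : Continuous fun θ => k (c θ) := kc.comp_continuous hcc hcs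
  set φ : ℝ → ℂ := fun θ => k (c θ) - k (c 0) - m * (θ * Complex.I) with hφ
  have hφc : Continuous φ := (hkc.sub continuous_const).sub (by fun_prop)
  have hinteger : ∀ θ, ∃ n : ℤ, φ θ = n * (2 * Real.pi * Complex.I) := fun θ => by
    have h1 : Complex.exp (k (c θ)) = Complex.exp (k (c 0) + m * (θ * Complex.I)) := by
      rw [ke _ (hcs θ), Complex.exp_add, ke _ (hcs 0), Complex.exp_int_mul, ← mul_zpow]
      simp [hc]
    obtain ⟨n, hn⟩ := Complex.exp_eq_exp_iff_exists_int.1 h1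
    exact ⟨n, by simp only [hφ, hn]; ring⟩
  have hconst : φ (2 * Real.pi) = φ 0 := constant_of_int_multiples hφc hinteger _ _
  have h0 : φ 0 = 0 := by simp [hφ]
  have hper : c (2 * Real.pi) = c 0 := by simp [hc]
  rw [h0] at hconst
  simp only [hφ, hper] at hconst
  have : (m : ℂ) = 0 := by
    have h2 : (2 * Real.pi * Complex.I : ℂ) ≠ 0 := Complex.two_pi_I_ne_zero
    push_cast at hconst
    have : (m : ℂ) * (2 * Real.pi * Complex.I) = 0 := by linear_combination -hconst
    exact (mul_eq_zero.1 this).resolve_right h2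
  exact_mod_cast this

/-- Homotopy lifting for the exponential. -/
theorem of_homotopy {F : unitInterval → ℂ → ℂ}
    (hF : ContinuousOn (fun p : unitInterval × ℂ => F p.1 p.2) (Set.univ ×ˢ S))
    (hne : ∀ t, ∀ z ∈ S, F t z ≠ 0) (h0 : HasLogOn (F 0) S) : HasLogOn (F 1) S := by
  classical
  obtain ⟨h, hc, he⟩ := h0
  let H : C(unitInterval × S, {z : ℂ // z ≠ 0}) :=
    ⟨fun p => ⟨F p.1 p.2, hne _ _ p.2.2⟩, by
      refine Continuous.subtype_mk ?_ _
      exact hF.comp_continuous (f := fun p : unitInterval × S => (p.1, (p.2 : ℂ)))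
        (by fun_prop) (fun p => ⟨trivial, p.2.2⟩)⟩
  let f0 : C(S, ℂ) := ⟨fun z => h z, continuousOn_iff_continuous_domRestrict.1 hc⟩
  have H0 : ∀ z, H (0, z) = ⟨_, Complex.exp_ne_zero (f0 z)⟩ := fun z =>
    Subtype.ext (he z z.2).symm
  let Γ := Complex.isCoveringMap_exp.liftHomotopy H f0 H0
  have hΓ : ∀ p, Complex.exp (Γ p) = F p.1 p.2 := fun p =>
    congrArg Subtype.val (congrFun (Complex.isCoveringMap_exp.liftHomotopy_lifts H f0 H0) p)
  refine ⟨fun z => if hz : z ∈ S then Γ (1, ⟨z, hz⟩) else 0, ?_, fun z hz => ?_⟩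
  · rw [continuousOn_iff_continuous_domRestrict]
    have : Continuous fun z : S => Γ (1, z) := by fun_prop
    convert! this using 2 with z
    simp [Set.domRestrict]
  · simp only [hz, dif_pos]
    exact hΓ _

theorem const {c : ℂ} (hc : c ≠ 0) : HasLogOn (fun _ => c) S :=
  ⟨fun _ => Complex.log c, continuousOn_const, fun _ _ => Complex.exp_log hc⟩

theorem of_continuous (hf : Continuous f) (hne : ∀ z, f z ≠ 0) : HasLogOn f S := by
  have := of_homotopy (S := S) (F := fun t z => f (t * z))
    (Continuous.continuousOn (by fun_prop)) (fun _ _ _ => hne _) (by simpa using const (hne 0))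
  simpa using this

/-- If `a` and `b` are joined by a path missing `S`, then `(z - b) / (z - a)` has a logarithm
on `S`. -/
theorem of_joinedIn {a b : ℂ} (hab : JoinedIn Sᶜ a b) :
    HasLogOn (fun z => (z - b) / (z - a)) S := by
  obtain ⟨γ, hγ⟩ := hab
  have hne : ∀ t, ∀ z ∈ S, z - γ t ≠ 0 := fun t z hz h0 =>
    hγ t ((sub_eq_zero.1 h0) ▸ hz)
  have := of_homotopy (S := S) (F := fun t z => (z - γ t) / (z - a)) ?_ ?_ ?_
  · simpa using this
  · refine ContinuousOn.div (Continuous.continuousOn (by fun_prop))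
      (Continuous.continuousOn (by fun_prop)) fun p hp => ?_
    simpa using hne 0 p.2 hp.2
  · exact fun t z hz => div_ne_zero (hne t z hz) (by simpa using hne 0 z hz)
  · refine (const (S := S) one_ne_zero).congr fun z hz => ?_
    have : z - a ≠ 0 := by simpa using hne 0 z hz
    simp [this]

/-- A nonvanishing continuous function on an arc has a logarithm. -/
theorem of_arc {γ : ℝ → ℂ} (hγ : ContinuousOn γ (Set.Icc 0 1)) (hinj : Set.InjOn γ (Set.Icc 0 1))
    (hf : ContinuousOn f (γ '' Set.Icc 0 1)) (hne : ∀ z ∈ γ '' Set.Icc 0 1, f z ≠ 0) :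
    HasLogOn f (γ '' Set.Icc 0 1) := by
  have hp : ∀ x : ℝ, (Set.projIcc (0 : ℝ) 1 zero_le_one x : ℝ) ∈ Set.Icc (0 : ℝ) 1 :=
    fun x => Subtype.coe_prop _
  have hg : Continuous fun z : ℂ => f (γ (Set.projIcc (0 : ℝ) 1 zero_le_one z.re)) := by
    refine hf.comp_continuous (hγ.comp_continuous (by fun_prop) fun x => hp _) fun x => ?_
    exact Set.mem_image_of_mem _ (hp _)
  obtain ⟨k, kc, ke⟩ := of_continuous (S := Set.univ) hg fun z => hne _ (Set.mem_image_of_mem _ (hp _))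
  let e : Set.Icc (0 : ℝ) 1 → γ '' Set.Icc 0 1 := fun x => ⟨γ x, Set.mem_image_of_mem _ x.2⟩
  have hec : Continuous e := (continuousOn_iff_continuous_domRestrict.1 hγ).subtype_mk _
  have hbij : Function.Bijective e := by
    constructor
    · intro x y hxy
      exact Subtype.ext (hinj x.2 y.2 (congrArg Subtype.val hxy))
    · rintro ⟨_, x, hx, rfl⟩
      exact ⟨⟨x, hx⟩, rfl⟩
  let E := (hec.homeoOfEquivCompactToT2 (f := Equiv.ofBijective e hbij))
  classical
  refine ⟨fun z => if hz : z ∈ γ '' Set.Icc 0 1 then k ((E.symm ⟨z, hz⟩ : ℝ)) else 0, ?_, ?_⟩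
  · rw [continuousOn_iff_continuous_domRestrict]
    have : Continuous fun z : γ '' Set.Icc 0 1 => k ((E.symm z : ℝ)) := by
      have := continuousOn_univ.1 kc
      fun_prop
    convert! this using 2 with z
    simp [Set.domRestrict]
  · intro z hz
    simp only [hz, dif_pos]
    rw [ke _ trivial]
    have : γ (E.symm ⟨z, hz⟩) = z := congrArg Subtype.val (E.apply_symm_apply ⟨z, hz⟩)
    simp only [Complex.ofReal_re, Set.projIcc_val, this]

/-- Logarithms on closed sets glue if they agree on the intersection. -/
theorem union {A B : Set ℂ} (hA : IsClosed A) (hB : IsClosed B) {h k : ℂ → ℂ}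
    (hc : ContinuousOn h A) (kc : ContinuousOn k B) (hf : ∀ z ∈ A, Complex.exp (h z) = f z)
    (kf : ∀ z ∈ B, Complex.exp (k z) = f z) (hk : ∀ z ∈ A ∩ B, h z = k z) :
    HasLogOn f (A ∪ B) := by
  classical
  refine ⟨fun z => if z ∈ A then h z else k z, ?_, ?_⟩
  · refine ContinuousOn.union_of_isClosed ?_ ?_ hA hB
    · exact hc.congr fun z hz => by simp [hz]
    · refine kc.congr fun z hz => ?_
      by_cases hzA : z ∈ A
      · simpa [hzA] using hk z ⟨hzA, hz⟩
      · simp [hzA]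
  · rintro z hz
    by_cases hzA : z ∈ A
    · simpa [hzA] using hf z hzA
    · simpa [hzA] using kf z (hz.resolve_left hzA)

end HasLogOn

theorem closure_pathComponentIn_compl_subset {K : Set ℂ} (hK : IsClosed K) (a : ℂ) :
    closure (pathComponentIn Kᶜ a) ⊆ pathComponentIn Kᶜ a ∪ K := by
  intro z hz
  by_cases hzK : z ∈ K
  · exact Or.inr hzK
  left
  have hopen := hK.isOpen_compl.pathComponentIn z
  obtain ⟨y, hy, hy'⟩ := mem_closure_iff.1 hz _ hopen (mem_pathComponentIn_self hzK)
  exact JoinedIn.trans hy' (JoinedIn.symm hy)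

/-- A point `a` of a complementary component of a compact set `K` has exponent zero in any
product `(z - a) ^ p * (z - b) ^ q * (z - c) ^ r` of total degree zero which has a logarithm
on `K`, if `b` and `c` lie in other complementary components. -/
theorem HasLogOn.exponent_eq_zero {K : Set ℂ} (hK : IsCompact K) {a b c : ℂ} (ha : a ∉ K)
    (hb : b ∉ K) (hc : c ∉ K) (hab : ¬ JoinedIn Kᶜ a b) (hac : ¬ JoinedIn Kᶜ a c) {p q r : ℤ}
    (hsum : p + q + r = 0)
    (hlog : HasLogOn (fun z => (z - a) ^ p * ((z - b) ^ q * (z - c) ^ r)) K) : p = 0 := by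
  classical
  set U : Set ℂ := pathComponentIn Kᶜ a with hU
  have hUo : IsOpen U := hK.isClosed.isOpen_compl.pathComponentIn a
  have haU : a ∈ U := mem_pathComponentIn_self ha
  have hcl : closure U ⊆ U ∪ K := closure_pathComponentIn_compl_subset hK.isClosed a
  have hfr : frontier U ⊆ K := fun z hz =>
    (hcl (frontier_subset_closure hz)).resolve_left fun h => by
      rw [hUo.frontier_eq] at hz
      exact hz.2 h
  obtain ⟨h, hcont, he⟩ := hlog
  obtain ⟨H, hH⟩ := ContinuousMap.exists_restrict_eq hK.isClosed
    (⟨K.domRestrict h, continuousOn_iff_continuous_domRestrict.1 hcont⟩ : C(K, ℂ))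
  have hHK : ∀ z ∈ K, H z = h z := fun z hz => congrArg (fun f : C(K, ℂ) => f ⟨z, hz⟩) hH
  set Ψ : ℂ → ℂ := fun z => if z ∈ U then (z - b) ^ q * (z - c) ^ r else
    Complex.exp (H z) * (z - a) ^ (-p) with hΨ
  have hbU : ∀ z ∈ U ∪ K, z - b ≠ 0 := fun z hz h0 => by
    rw [sub_eq_zero] at h0
    subst h0
    exact hz.elim hab hb
  have hcU : ∀ z ∈ U ∪ K, z - c ≠ 0 := fun z hz h0 => by
    rw [sub_eq_zero] at h0
    subst h0
    exact hz.elim hac hc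
  have haU' : ∀ z, z ∉ U → z - a ≠ 0 := fun z hz h0 => hz ((sub_eq_zero.1 h0) ▸ haU)
  have hΨc : Continuous Ψ := by
    refine continuous_if (p := fun z => z ∈ U) ?_ ?_ ?_
    · intro z hz
      have hzK := hfr hz
      have hza : z - a ≠ 0 := fun h0 => ha ((sub_eq_zero.1 h0) ▸ hzK)
      rw [hHK z hzK, he z hzK]
      simp only
      rw [mul_comm ((z - a) ^ p), mul_assoc, ← zpow_add₀ hza]
      simp
    · refine ContinuousOn.mul ?_ ?_
      · exact ContinuousOn.zpow₀ (by fun_prop) _ fun z hz => Or.inl (hbU z (hcl hz))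
      · exact ContinuousOn.zpow₀ (by fun_prop) _ fun z hz => Or.inl (hcU z (hcl hz))
    · have : closure {z | ¬ z ∈ U} = Uᶜ := hUo.isClosed_compl.closure_eq
      rw [this]
      refine ContinuousOn.mul (by fun_prop) ?_
      exact ContinuousOn.zpow₀ (by fun_prop) _ fun z hz => Or.inl (haU' z hz)
  have hΨ0 : ∀ z, Ψ z ≠ 0 := by
    intro z
    by_cases hz : z ∈ U
    · simp only [hΨ, hz, if_true]
      exact mul_ne_zero (zpow_ne_zero _ (hbU z (Or.inl hz))) (zpow_ne_zero _ (hcU z (Or.inl hz)))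
    · simp only [hΨ, hz, if_false]
      exact mul_ne_zero (Complex.exp_ne_zero _) (zpow_ne_zero _ (haU' z hz))
  obtain ⟨R₀, hR₀⟩ := hK.isBounded.subset_closedBall a
  set R : ℝ := max R₀ (max (Dist.dist b a) (Dist.dist c a)) + 1 with hRdef
  have hR1 : R₀ < R := by rw [hRdef]; linarith [le_max_left R₀ (max (Dist.dist b a) (Dist.dist c a))]
  have hRb : Dist.dist b a < R := by
    have := (le_max_left (Dist.dist b a) (Dist.dist c a)).trans (le_max_right R₀ _)
    rw [hRdef]; linarith
  have hRc : Dist.dist c a < R := by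
    have := (le_max_right (Dist.dist b a) (Dist.dist c a)).trans (le_max_right R₀ _)
    rw [hRdef]; linarith
  have hR : 0 < R := dist_nonneg.trans_lt hRb
  have hlogΨ : HasLogOn Ψ (Metric.sphere a R) := of_continuous hΨc hΨ0
  have hza : ∀ z ∈ Metric.sphere a R, z - a ≠ 0 := fun z hz h0 => by
    rw [sub_eq_zero.1 h0, Metric.mem_sphere, _root_.dist_self] at hz
    exact hR.ne hz
  have hsphere : Metric.sphere a R ⊆ Kᶜ := fun z hz hzK => by
    have := hR₀ hzK
    rw [Metric.mem_closedBall, Metric.mem_sphere.1 hz] at this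
    linarith
  by_cases hmeet : ∃ w ∈ Metric.sphere a R, w ∈ U
  · obtain ⟨w, hw, hwU⟩ := hmeet
    have hsub : ∀ z ∈ Metric.sphere a R, z ∈ U := fun z hz =>
      JoinedIn.trans hwU (((isPathConnected_sphere (by simp) a hR.le).joinedIn w hw z hz).mono
        hsphere)
    have hratio : ∀ x, Dist.dist x a < R →
        HasLogOn (fun z => ((z - x) / (z - a))⁻¹) (Metric.sphere a R) := fun x hx => by
      refine (of_norm_sub_one_lt ?_ fun z hz => ?_).inv
      · exact ContinuousOn.div (by fun_prop) (by fun_prop) hza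
      · have h1 : (z - x) / (z - a) - 1 = (a - x) / (z - a) := by
          field_simp [hza z hz]
          ring
        rw [h1, norm_div, ← dist_eq_norm, ← dist_eq_norm, Metric.mem_sphere.1 hz, _root_.dist_comm,
          div_lt_one hR]
        exact hx
    have hqr : HasLogOn (fun z => (z - a) ^ (q + r)) (Metric.sphere a R) := by
      refine ((hlogΨ.mul ((hratio b hRb).zpow q)).mul ((hratio c hRc).zpow r)).congr fun z hz => ?_
      have hzU := hsub z hz
      have h1 := hza z hz
      have h2 := hbU z (Or.inl hzU)
      have h3 := hcU z (Or.inl hzU)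
      simp only [hΨ, hzU, if_true, inv_div, div_zpow, zpow_add₀ h1]
      field_simp
    have := of_sphere_zpow hR hqr
    omega
  · have hp : HasLogOn (fun z => (z - a) ^ (-p)) (Metric.sphere a R) := by
      have hexp : HasLogOn (fun z => (Complex.exp (H z))⁻¹) (Metric.sphere a R) :=
        HasLogOn.inv (f := fun z => Complex.exp (H z))
          ⟨H, H.continuous.continuousOn, fun _ _ => rfl⟩
      refine (hexp.mul hlogΨ).congr fun z hz => ?_
      have hzU : z ∉ U := fun h => hmeet ⟨z, hz, h⟩
      simp only [hΨ, hzU, if_false]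
      rw [← mul_assoc, inv_mul_cancel₀ (Complex.exp_ne_zero _), one_mul]
    have := of_sphere_zpow hR hp
    omega

theorem JoinedIn.of_hasLogOn {K : Set ℂ} (hK : IsCompact K) {a b : ℂ} (ha : a ∉ K)
    (hb : b ∉ K) (hlog : HasLogOn (fun z => (z - b) / (z - a)) K) : JoinedIn Kᶜ a b := by
  by_contra hab
  have : (-1 : ℤ) = 0 := HasLogOn.exponent_eq_zero hK ha hb hb hab hab (q := 1) (r := 0) (by simp)
    (hlog.congr fun z _ => by simp [div_eq_mul_inv, mul_comm])
  omega

theorem HasLogOn.glue {A B : Set ℂ} (hA : IsClosed A) (hB : IsClosed B) {f h k : ℂ → ℂ}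
    (hc : ContinuousOn h A) (kc : ContinuousOn k B) (he : ∀ z ∈ A, Complex.exp (h z) = f z)
    (ke : ∀ z ∈ B, Complex.exp (k z) = f z) {x : ℂ} (hxA : x ∈ A) (hxB : x ∈ B)
    (hk : ∀ y ∈ A ∩ B, h y - k y = h x - k x) : HasLogOn f (A ∪ B) := by
  have h1 : Complex.exp (h x - k x) = 1 := by
    rw [Complex.exp_sub, he x hxA, ke x hxB, div_self]
    rw [← he x hxA]
    exact Complex.exp_ne_zero _
  refine HasLogOn.union (k := fun z => k z + (h x - k x)) hA hB hc
    (kc.add (continuousOn_const (c := h x - k x))) he ?_ ?_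
  · intro z hz
    rw [Complex.exp_add, ke z hz, h1, mul_one]
  · intro z hz
    rw [← hk z hz]
    ring

/-- `γ` restricts to a simple arc on the unit interval. -/
structure IsSimpleArc (γ : ℝ → ℂ) : Prop where
  continuousOn : ContinuousOn γ (Set.Icc 0 1)
  injOn : Set.InjOn γ (Set.Icc 0 1)

namespace IsSimpleArc

variable {γ : ℝ → ℂ} {A : Set ℂ} {a b c : ℂ}

theorem isCompact (hγ : IsSimpleArc γ) : IsCompact (γ '' Set.Icc 0 1) :=
  isCompact_Icc.image_of_continuousOn hγ.continuousOn

theorem ratio_continuousOn {S : Set ℂ} (ha : a ∉ S) :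
    ContinuousOn (fun z => (z - b) / (z - a)) S :=
  ContinuousOn.div (by fun_prop) (by fun_prop) fun _ hz h0 => ha ((sub_eq_zero.1 h0) ▸ hz)

theorem ratio_ne_zero {S : Set ℂ} (ha : a ∉ S) (hb : b ∉ S) : ∀ z ∈ S, (z - b) / (z - a) ≠ 0 :=
  fun _ hz => div_ne_zero (fun h0 => hb ((sub_eq_zero.1 h0) ▸ hz))
    (fun h0 => ha ((sub_eq_zero.1 h0) ▸ hz))

theorem hasLogOn_ratio (hγ : IsSimpleArc γ) (ha : a ∉ γ '' Set.Icc 0 1)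
    (hb : b ∉ γ '' Set.Icc 0 1) : HasLogOn (fun z => (z - b) / (z - a)) (γ '' Set.Icc 0 1) :=
  HasLogOn.of_arc hγ.continuousOn hγ.injOn (ratio_continuousOn ha) (ratio_ne_zero ha hb)

/-- Attaching an arc at a single point does not separate points. -/
theorem joinedIn_of_pendant (hγ : IsSimpleArc γ) (hA : IsCompact A) {x : ℂ} (hxA : x ∈ A)
    (hx : x ∈ γ '' Set.Icc 0 1) (hinter : A ∩ γ '' Set.Icc 0 1 ⊆ {x})
    (ha : a ∉ A ∪ γ '' Set.Icc 0 1) (hb : b ∉ A ∪ γ '' Set.Icc 0 1) (hab : JoinedIn Aᶜ a b) :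
    JoinedIn (A ∪ γ '' Set.Icc 0 1)ᶜ a b := by
  refine JoinedIn.of_hasLogOn (hA.union hγ.isCompact) ha hb ?_
  obtain ⟨h, hc, he⟩ := HasLogOn.of_joinedIn hab
  rw [Set.mem_union, not_or] at ha hb
  obtain ⟨k, kc, ke⟩ := hγ.hasLogOn_ratio ha.2 hb.2
  refine HasLogOn.glue hA.isClosed hγ.isCompact.isClosed hc kc he ke hxA hx fun y hy => ?_
  rw [hinter hy]

/-- Attaching an arc at its two endpoints splits a complementary component in at most
two pieces. -/
theorem not_three_components (hγ : IsSimpleArc γ) (hA : IsCompact A)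
    (h0A : γ 0 ∈ A) (h1A : γ 1 ∈ A) (hinter : A ∩ γ '' Set.Icc 0 1 ⊆ {γ 0, γ 1})
    (ha : a ∉ A ∪ γ '' Set.Icc 0 1) (hb : b ∉ A ∪ γ '' Set.Icc 0 1)
    (hc : c ∉ A ∪ γ '' Set.Icc 0 1) (hab : JoinedIn Aᶜ a b) (hac : JoinedIn Aᶜ a c)
    (nab : ¬ JoinedIn (A ∪ γ '' Set.Icc 0 1)ᶜ a b) (nac : ¬ JoinedIn (A ∪ γ '' Set.Icc 0 1)ᶜ a c)
    (nbc : ¬ JoinedIn (A ∪ γ '' Set.Icc 0 1)ᶜ b c) : False := by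
  have hK := hA.union hγ.isCompact
  have hB := hγ.isCompact.isClosed
  have h0 : γ 0 ∈ γ '' Set.Icc 0 1 := Set.mem_image_of_mem _ (by simp)
  have h1 : γ 1 ∈ γ '' Set.Icc 0 1 := Set.mem_image_of_mem _ (by simp)
  have ha' := not_or.1 ha
  have hb' := not_or.1 hb
  have hc' := not_or.1 hc
  obtain ⟨h₁, hc₁, he₁⟩ := HasLogOn.of_joinedIn hab
  obtain ⟨k₁, kc₁, ke₁⟩ := hγ.hasLogOn_ratio ha'.2 hb'.2
  obtain ⟨h₂, hc₂, he₂⟩ := HasLogOn.of_joinedIn hac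
  obtain ⟨k₂, kc₂, ke₂⟩ := hγ.hasLogOn_ratio ha'.2 hc'.2
  have key : ∀ h k f : ℂ → ℂ, (∀ z ∈ A, Complex.exp (h z) = f z) →
      (∀ z ∈ γ '' Set.Icc 0 1, Complex.exp (k z) = f z) →
      ∃ n : ℤ, (h (γ 1) - k (γ 1)) - (h (γ 0) - k (γ 0)) = n * (2 * Real.pi * Complex.I) := by
    intro h k f he ke
    have e0 := (he _ h0A).trans (ke _ h0).symm
    have e1 := (he _ h1A).trans (ke _ h1).symm
    obtain ⟨n0, hn0⟩ := Complex.exp_eq_exp_iff_exists_int.1 e0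
    obtain ⟨n1, hn1⟩ := Complex.exp_eq_exp_iff_exists_int.1 e1
    refine ⟨n1 - n0, ?_⟩
    rw [hn0, hn1]
    push_cast
    ring
  obtain ⟨n₁, hn₁⟩ := key h₁ k₁ _ he₁ ke₁
  obtain ⟨n₂, hn₂⟩ := key h₂ k₂ _ he₂ ke₂
  have hlog : HasLogOn (fun z => ((z - b) / (z - a)) ^ n₂ * ((z - c) / (z - a)) ^ (-n₁))
      (A ∪ γ '' Set.Icc 0 1) := by
    refine HasLogOn.glue hA.isClosed hB (h := fun z => n₂ * h₁ z + (-n₁ : ℤ) * h₂ z)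
      (k := fun z => n₂ * k₁ z + (-n₁ : ℤ) * k₂ z) (by fun_prop) (by fun_prop) ?_ ?_ h0A h0 ?_
    · intro z hz
      rw [Complex.exp_add, Complex.exp_int_mul, Complex.exp_int_mul, he₁ z hz, he₂ z hz]
    · intro z hz
      rw [Complex.exp_add, Complex.exp_int_mul, Complex.exp_int_mul, ke₁ z hz, ke₂ z hz]
    · intro y hy
      rcases hinter hy with rfl | hy
      · rfl
      · rw [Set.mem_singleton_iff.1 hy]
        push_cast
        linear_combination (n₂ : ℂ) * hn₁ - (n₁ : ℂ) * hn₂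
  have sne : ∀ x, x ∉ A ∪ γ '' Set.Icc 0 1 → ∀ z ∈ A ∪ γ '' Set.Icc 0 1, z - x ≠ 0 :=
    fun x hx z hz h0 => hx ((sub_eq_zero.1 h0) ▸ hz)
  have e₁ : n₂ = 0 := by
    refine HasLogOn.exponent_eq_zero hK hb ha hc (fun h => nab h.symm) nbc
      (q := n₁ - n₂) (r := -n₁) (by ring) (hlog.congr fun z hz => ?_)
    have := sne a ha z hz
    rw [zpow_sub₀ this, div_zpow, div_zpow, zpow_neg (z - a)]
    field_simp
  have e₂ : -n₁ = 0 := by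
    refine HasLogOn.exponent_eq_zero hK hc ha hb (fun h => nac h.symm) (fun h => nbc h.symm)
      (q := n₁ - n₂) (r := n₂) (by ring) (hlog.congr fun z hz => ?_)
    have := sne a ha z hz
    rw [zpow_sub₀ this, div_zpow, div_zpow, zpow_neg (z - a)]
    field_simp
  have hn₁0 : n₁ = 0 := by omega
  refine nab (JoinedIn.of_hasLogOn hK ha hb ?_)
  refine HasLogOn.glue hA.isClosed hB hc₁ kc₁ he₁ ke₁ h0A h0 fun y hy => ?_
  rcases hinter hy with rfl | hy
  · rfl
  · rw [Set.mem_singleton_iff.1 hy]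
    rw [hn₁0] at hn₁
    linear_combination hn₁

theorem not_hasLogOn_ratio {u v : ℂ} (huv : u ≠ v) :
    ¬ HasLogOn (fun z => (z - v) / (z - u)) {u, v}ᶜ := by
  intro hlog
  have hd : 0 < Dist.dist u v / 2 := half_pos (dist_pos.2 huv)
  have hvu : u - v ≠ 0 := sub_ne_zero.2 huv
  have hne : ∀ z ∈ Metric.sphere u (Dist.dist u v / 2), z - v ≠ 0 ∧ z - u ≠ 0 := by
    intro z hz
    rw [Metric.mem_sphere] at hz
    constructor <;> intro h0 <;> rw [sub_eq_zero] at h0 <;> subst h0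
    · rw [_root_.dist_comm] at hz; linarith
    · rw [_root_.dist_self] at hz; linarith
  have h1 : HasLogOn (fun z => (z - v) / (u - v)) (Metric.sphere u (Dist.dist u v / 2)) := by
    refine HasLogOn.of_norm_sub_one_lt (by fun_prop) fun z hz => ?_
    have : (z - v) / (u - v) - 1 = (z - u) / (u - v) := by
      field_simp
      ring
    rw [this, norm_div, ← dist_eq_norm, ← dist_eq_norm, Metric.mem_sphere.1 hz]
    rw [div_lt_one (by linarith)]
    linarith
  have h2 := (hlog.mono (S := Metric.sphere u (Dist.dist u v / 2)) fun z hz => by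
    have := hne z hz
    simpa [sub_eq_zero] using this.symm).inv
  have h3 : HasLogOn (fun z => (z - u) ^ (1 : ℤ)) (Metric.sphere u (Dist.dist u v / 2)) := by
    refine ((h1.mul h2).mul (HasLogOn.const hvu)).congr fun z hz => ?_
    obtain ⟨ha, hb⟩ := hne z hz
    field_simp
  exact absurd (HasLogOn.of_sphere_zpow hd h3) one_ne_zero

/-- Attaching an arc at two points which are joined in `A` separates points. -/
theorem exists_separated (hγ : IsSimpleArc γ) (hA : IsClosed A)
    (hdisj : Disjoint A (γ '' Set.Ioo 0 1)) (hjoin : JoinedIn A (γ 0) (γ 1)) :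
    ∃ a b, a ∉ A ∪ γ '' Set.Icc 0 1 ∧ b ∉ A ∪ γ '' Set.Icc 0 1 ∧ JoinedIn Aᶜ (γ (1 / 2)) a ∧
      JoinedIn Aᶜ (γ (1 / 2)) b ∧ ¬ JoinedIn (A ∪ γ '' Set.Icc 0 1)ᶜ a b := by
  classical
  by_contra hcon
  set e := γ '' Set.Icc 0 1 with he
  have hclosed : IsClosed e := hγ.isCompact.isClosed
  have huv : γ 0 ≠ γ 1 := fun h => zero_ne_one (hγ.injOn (by simp) (by simp) h)
  set m := γ (1 / 2) with hm
  set V₀ := pathComponentIn Aᶜ m with hV₀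
  have hV₀o : IsOpen V₀ := hA.isOpen_compl.pathComponentIn m
  have hV₀A : V₀ ⊆ Aᶜ := pathComponentIn_subset
  have hall : ∀ a ∈ V₀ \ e, ∀ b ∈ V₀ \ e, JoinedIn (A ∪ e)ᶜ a b := by
    intro a ha b hb
    by_contra hab
    exact hcon ⟨a, b, fun h => h.elim (hV₀A ha.1) ha.2, fun h => h.elim (hV₀A hb.1) hb.2,
      ha.1, hb.1, hab⟩
  have harcV : γ '' Set.Ioo 0 1 ⊆ V₀ := by
    rintro _ ⟨t, ht, rfl⟩
    have hpc : IsPathConnected (γ '' Set.Ioo 0 1) :=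
      ((convex_Ioo (0 : ℝ) 1).isPathConnected ⟨1 / 2, by norm_num⟩).image'
        (hγ.continuousOn.mono Set.Ioo_subset_Icc_self)
    exact (hpc.joinedIn _ (Set.mem_image_of_mem _ (by norm_num)) _
      (Set.mem_image_of_mem _ ht)).mono fun z hz hzA => hdisj.le_bot ⟨hzA, hz⟩
  have he_cases : ∀ z ∈ e, z = γ 0 ∨ z = γ 1 ∨ z ∈ V₀ := by
    rintro _ ⟨t, ht, rfl⟩
    rcases ht.1.eq_or_lt with rfl | h0
    · exact Or.inl rfl
    rcases ht.2.eq_or_lt with rfl | h1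
    · exact Or.inr (Or.inl rfl)
    exact Or.inr (Or.inr (harcV ⟨t, ⟨h0, h1⟩, rfl⟩))
  have hjoin_e : JoinedIn e (γ 0) (γ 1) := JoinedIn.ofLine hγ.continuousOn rfl rfl he.ge
  obtain ⟨hU, hUc, hUe⟩ := HasLogOn.of_joinedIn (S := eᶜ) (by rwa [compl_compl])
  obtain ⟨hV, hVc, hVe⟩ := HasLogOn.of_joinedIn (S := Aᶜ) (by rwa [compl_compl])
  have hdiff : ∃ C : ℂ, Complex.exp C = 1 ∧ ∀ z ∈ V₀ \ e, hV z + C = hU z := by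
    by_cases hne : (V₀ \ e).Nonempty
    · obtain ⟨z₀, hz₀⟩ := hne
      refine ⟨hU z₀ - hV z₀, ?_, fun z hz => ?_⟩
      · rw [Complex.exp_sub, hUe z₀ hz₀.2, hVe z₀ (hV₀A hz₀.1), div_self]
        rw [← hUe z₀ hz₀.2]
        exact Complex.exp_ne_zero _
      · have := (hall z₀ hz₀ z hz).sub_eq_of_exp_eq
          (hUc.mono fun z hz h => hz (Or.inr h)) (hVc.mono fun z hz h => hz (Or.inl h))
          fun z hz => by
            rw [hUe z fun h => hz (Or.inr h), hVe z fun h => hz (Or.inl h)]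
        rw [this]
        ring
    · refine ⟨0, Complex.exp_zero, fun z hz => (hne ⟨z, hz⟩).elim⟩
  obtain ⟨C, hC, hCU⟩ := hdiff
  refine not_hasLogOn_ratio huv ⟨fun z => if z ∈ V₀ then hV z + C else hU z, ?_, ?_⟩
  · intro z hz
    apply ContinuousAt.continuousWithinAt
    by_cases hzV : z ∈ V₀
    · have h1 : ContinuousAt (fun z => hV z + C) z :=
        (hVc.continuousAt (hA.isOpen_compl.mem_nhds (hV₀A hzV))).add continuousAt_const
      refine h1.congr ?_
      filter_upwards [hV₀o.mem_nhds hzV] with w hw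
      simp [hw]
    · have hze : z ∉ e := fun h => by
        rcases he_cases z h with h | h | h
        · exact hz (by simp [h])
        · exact hz (by simp [h])
        · exact hzV h
      refine (hUc.continuousAt (hclosed.isOpen_compl.mem_nhds hze)).congr ?_
      filter_upwards [hclosed.isOpen_compl.mem_nhds hze] with w hw
      by_cases hwV : w ∈ V₀
      · simp [hwV, hCU w ⟨hwV, hw⟩]
      · simp [hwV]
  · intro z hz
    by_cases hzV : z ∈ V₀
    · simp only [hzV, if_true]
      rw [Complex.exp_add, hVe z (hV₀A hzV), hC, mul_one]
    · simp only [hzV, if_false]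
      refine hUe z fun h => ?_
      rcases he_cases z h with h | h | h
      · exact hz (by simp [h])
      · exact hz (by simp [h])
      · exact hzV h

end IsSimpleArc

/-- Simple arcs with endpoints in a finite set `P` of points, and otherwise disjoint from each
other and from `P`. -/
structure IsArcSystem {E : Type*} (γ : E → ℝ → ℂ) (P : Set ℂ) : Prop where
  finite : P.Finite
  arc : ∀ e, IsSimpleArc (γ e)
  zero_mem : ∀ e, γ e 0 ∈ P
  one_mem : ∀ e, γ e 1 ∈ P
  notMem : ∀ e, ∀ t ∈ Set.Ioo (0 : ℝ) 1, γ e t ∉ P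
  eq_of_eq : ∀ e e', ∀ t ∈ Set.Ioo (0 : ℝ) 1, ∀ t' ∈ Set.Ioo (0 : ℝ) 1, γ e t = γ e' t' → e = e'

/-- The union of the points in `P` and the arcs with index in `H`. -/
def skeleton {E : Type*} (γ : E → ℝ → ℂ) (P : Set ℂ) (H : Set E) : Set ℂ :=
  P ∪ ⋃ e ∈ H, γ e '' Set.Icc 0 1

/-- The complementary component of `a` has a point of the open arc `e` in its closure. -/
def Borders {E : Type*} (γ : E → ℝ → ℂ) (P : Set ℂ) (a : ℂ) (e : E) : Prop :=
  ∃ t ∈ Set.Ioo (0 : ℝ) 1, γ e t ∈ closure (pathComponentIn (skeleton γ P Set.univ)ᶜ a)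

/-- The arcs that separate the complementary component of `a` from another one. -/
def faceBoundary {E : Type*} (γ : E → ℝ → ℂ) (P : Set ℂ) (a : ℂ) : Set E :=
  {e | Borders γ P a e ∧ ∃ b ∉ skeleton γ P Set.univ,
    Borders γ P b e ∧ ¬ JoinedIn (skeleton γ P Set.univ)ᶜ a b}

theorem skeleton_mono {E : Type*} {γ : E → ℝ → ℂ} {P : Set ℂ} {H H' : Set E} (h : H ⊆ H') :
    skeleton γ P H ⊆ skeleton γ P H' :=
  Set.union_subset_union_right _ (Set.biUnion_subset_biUnion_left h)

theorem skeleton_insert {E : Type*} {γ : E → ℝ → ℂ} {P : Set ℂ} (e : E) (H : Set E) :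
    skeleton γ P (insert e H) = skeleton γ P H ∪ γ e '' Set.Icc 0 1 := by
  rw [skeleton, skeleton, Set.biUnion_insert, Set.union_assoc, Set.union_comm (γ e '' _)]

theorem arc_subset_skeleton {E : Type*} {γ : E → ℝ → ℂ} {P : Set ℂ} {e : E} {H : Set E}
    (he : e ∈ H) : γ e '' Set.Icc 0 1 ⊆ skeleton γ P H :=
  (Set.subset_biUnion_of_mem (u := fun e => γ e '' Set.Icc 0 1) he).trans Set.subset_union_right

theorem Borders.congr {E : Type*} {γ : E → ℝ → ℂ} {P : Set ℂ} {a b : ℂ} {e : E}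
    (hb : Borders γ P a e) (h : JoinedIn (skeleton γ P Set.univ)ᶜ a b) : Borders γ P b e := by
  obtain ⟨t, ht, hcl⟩ := hb
  refine ⟨t, ht, closure_mono (fun z hz => ?_) hcl⟩
  exact h.symm.trans hz

namespace IsArcSystem

variable {E : Type*} {γ : E → ℝ → ℂ} {P : Set ℂ} {H : Set E}

theorem mem_or_mem_Ioo (h : IsArcSystem γ P) {e : E} {z : ℂ} (hz : z ∈ γ e '' Set.Icc 0 1) :
    z ∈ P ∨ z ∈ γ e '' Set.Ioo 0 1 := by
  obtain ⟨t, ht, rfl⟩ := hz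
  rcases eq_or_lt_of_le ht.1 with h0 | h0
  · exact Or.inl (h0 ▸ h.zero_mem e)
  rcases eq_or_lt_of_le ht.2 with h1 | h1
  · exact Or.inl (h1 ▸ h.one_mem e)
  · exact Or.inr ⟨t, ⟨h0, h1⟩, rfl⟩

theorem mem_endpoints (h : IsArcSystem γ P) {e : E} {z : ℂ} (hz : z ∈ γ e '' Set.Icc 0 1)
    (hP : z ∈ P) : z = γ e 0 ∨ z = γ e 1 := by
  obtain ⟨t, ht, rfl⟩ := hz
  rcases eq_or_lt_of_le ht.1 with h0 | h0
  · exact Or.inl (h0 ▸ rfl)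
  rcases eq_or_lt_of_le ht.2 with h1 | h1
  · exact Or.inr (h1 ▸ rfl)
  · exact absurd hP (h.notMem e t ⟨h0, h1⟩)

theorem mem_of_mem_skeleton (h : IsArcSystem γ P) {e : E} {t : ℝ} (ht : t ∈ Set.Ioo (0 : ℝ) 1)
    (hz : γ e t ∈ skeleton γ P H) : e ∈ H := by
  rcases hz with hz | hz
  · exact absurd hz (h.notMem e t ht)
  · obtain ⟨e', he', hz⟩ := Set.mem_iUnion₂.1 hz
    rcases h.mem_or_mem_Ioo hz with hz | ⟨t', ht', hz⟩
    · exact absurd hz (h.notMem e t ht)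
    · exact h.eq_of_eq _ _ _ ht' _ ht hz ▸ he'

theorem inter_subset_endpoints (h : IsArcSystem γ P) {e : E} (he : e ∉ H) :
    skeleton γ P H ∩ γ e '' Set.Icc 0 1 ⊆ {γ e 0, γ e 1} := by
  rintro z ⟨hz, hze⟩
  rcases h.mem_or_mem_Ioo hze with hP | ⟨t, ht, rfl⟩
  · exact h.mem_endpoints hze hP
  · exact absurd (h.mem_of_mem_skeleton ht hz) he

theorem isCompact_skeleton [Finite E] (h : IsArcSystem γ P) : IsCompact (skeleton γ P H) :=
  h.finite.isCompact.union (H.toFinite.isCompact_biUnion fun e _ => (h.arc e).isCompact)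

theorem joinedIn_arc (h : IsArcSystem γ P) {e : E} (he : e ∉ H) {s t : ℝ}
    (hs : s ∈ Set.Ioo (0 : ℝ) 1) (ht : t ∈ Set.Ioo (0 : ℝ) 1) :
    JoinedIn (skeleton γ P H)ᶜ (γ e s) (γ e t) := by
  have h1 : IsPathConnected (γ e '' Set.Ioo 0 1) :=
    ((convex_Ioo 0 1).isPathConnected ⟨s, hs⟩).image'
      ((h.arc e).continuousOn.mono Set.Ioo_subset_Icc_self)
  refine (h1.joinedIn _ ⟨s, hs, rfl⟩ _ ⟨t, ht, rfl⟩).mono ?_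
  rintro _ ⟨r, hr, rfl⟩ hm
  exact he (h.mem_of_mem_skeleton hr hm)

theorem joinedIn_of_borders [Finite E] (h : IsArcSystem γ P) {e : E} (he : e ∉ H) {a : ℂ}
    (hb : Borders γ P a e) : JoinedIn (skeleton γ P H)ᶜ a (γ e (1 / 2)) := by
  obtain ⟨t, ht, hcl⟩ := hb
  have hn : γ e t ∉ skeleton γ P H := fun hm => he (h.mem_of_mem_skeleton ht hm)
  obtain ⟨y, hy, hy'⟩ := mem_closure_iff.1 hcl _
    (h.isCompact_skeleton.isClosed.isOpen_compl.pathComponentIn (γ e t))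
    (mem_pathComponentIn_self hn)
  have h1 : JoinedIn (skeleton γ P H)ᶜ a y :=
    JoinedIn.mono hy' (Set.compl_subset_compl.2 (skeleton_mono (Set.subset_univ H)))
  exact (h1.trans (JoinedIn.symm hy)).trans (h.joinedIn_arc he ht (by norm_num))

theorem eventually_borders [Finite E] (h : IsArcSystem γ P) {e : E} {t : ℝ}
    (ht : t ∈ Set.Ioo (0 : ℝ) 1) : ∀ᶠ q in nhds (γ e t),
      (q ∉ skeleton γ P Set.univ ∧ Borders γ P q e) ∨ q ∈ γ e '' Set.Ioo 0 1 := by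
  have huniv : skeleton γ P Set.univ = skeleton γ P {e}ᶜ ∪ γ e '' Set.Icc 0 1 := by
    rw [← skeleton_insert, Set.insert_eq, Set.union_compl_self]
  have hn : γ e t ∈ (skeleton γ P {e}ᶜ)ᶜ := fun hm => h.mem_of_mem_skeleton ht hm rfl
  obtain ⟨ε, hε, hball⟩ := Metric.isOpen_iff.1 h.isCompact_skeleton.isClosed.isOpen_compl _ hn
  have harc : ∀ z ∈ Metric.ball (γ e t) ε, z ∈ skeleton γ P Set.univ → z ∈ γ e '' Set.Ioo 0 1 := by
    intro z hz hK
    rw [huniv] at hK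
    rcases hK with hK | hK
    · exact absurd hK (hball hz)
    · exact (h.mem_or_mem_Ioo hK).resolve_left fun hP => hball hz (Or.inl hP)
  filter_upwards [Metric.ball_mem_nhds _ hε] with q hq
  by_cases hK : q ∈ skeleton γ P Set.univ
  · exact Or.inr (harc q hq hK)
  refine Or.inl ⟨hK, ?_⟩
  by_contra hb
  have hcl := h.isCompact_skeleton (H := Set.univ) |>.isClosed
  have hsub := (convex_ball (γ e t) ε).isPreconnected.subset_of_closure_inter_subset
    (hcl.isOpen_compl.pathComponentIn q) ⟨q, hq, mem_pathComponentIn_self hK⟩ ?_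
  · exact pathComponentIn_subset (hsub (Metric.mem_ball_self hε))
      (arc_subset_skeleton (Set.mem_univ e) ⟨t, Set.Ioo_subset_Icc_self ht, rfl⟩)
  · rintro z ⟨hz, hzb⟩
    refine (closure_pathComponentIn_compl_subset hcl q hz).resolve_right fun hzK => hb ?_
    obtain ⟨s, hs, rfl⟩ := harc z hzb hzK
    exact ⟨s, hs, hz⟩

/-- If no arc outside `H` borders both a component in `S` and a component outside `S`, then
`S` is a union of components of the complement of `H`, up to arcs. -/
theorem not_joinedIn_of_saturated [Finite E] (h : IsArcSystem γ P) {S : Set ℂ}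
    (hSK : ∀ a ∈ S, a ∉ skeleton γ P Set.univ)
    (hS : ∀ a ∈ S, ∀ b, JoinedIn (skeleton γ P Set.univ)ᶜ a b → b ∈ S)
    (hH : ∀ e ∉ H, ∀ a ∈ S, Borders γ P a e → ∀ b ∉ skeleton γ P Set.univ, Borders γ P b e → b ∈ S)
    {a b : ℂ} (ha : a ∈ S) (hb : b ∉ skeleton γ P Set.univ) (hbS : b ∉ S) :
    ¬ JoinedIn (skeleton γ P H)ᶜ a b := by
  intro hab
  have hcl := h.isCompact_skeleton (H := Set.univ) |>.isClosed
  set U : Set ℂ := S ∪ {z | ∃ e ∉ H, (∃ a ∈ S, Borders γ P a e) ∧ z ∈ γ e '' Set.Ioo 0 1} with hU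
  have hopen : IsOpen U := by
    rw [isOpen_iff_eventually]
    rintro z (hz | ⟨e, he, ⟨c, hc, hce⟩, t, ht, rfl⟩)
    · filter_upwards [(hcl.isOpen_compl.pathComponentIn z).mem_nhds
        (mem_pathComponentIn_self (hSK z hz))] with q hq
      exact Or.inl (hS z hz q hq)
    · filter_upwards [h.eventually_borders ht] with q hq
      rcases hq with ⟨hq, hqe⟩ | hq
      · exact Or.inl (hH e he c hc hce q hq hqe)
      · exact Or.inr ⟨e, he, ⟨c, hc, hce⟩, hq⟩
  have hclos : closure U ∩ (skeleton γ P H)ᶜ ⊆ U := by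
    rintro z ⟨hz, hzH⟩
    by_cases hzK : z ∈ skeleton γ P Set.univ
    · rcases hzK with hP | hzK
      · exact absurd (Or.inl hP) hzH
      obtain ⟨e, -, hze⟩ := Set.mem_iUnion₂.1 hzK
      obtain ⟨t, ht, rfl⟩ := (h.mem_or_mem_Ioo hze).resolve_left fun hP => hzH (Or.inl hP)
      have he : e ∉ H := fun he => hzH (arc_subset_skeleton he hze)
      obtain ⟨q, hqU, hq⟩ := ((mem_closure_iff_frequently.1 hz).and_eventually
        (h.eventually_borders ht)).exists
      rcases hqU with hqS | ⟨e', he', hc, t', ht', rfl⟩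
      · rcases hq with ⟨hq, hqe⟩ | ⟨s, hs, rfl⟩
        · exact Or.inr ⟨e, he, ⟨q, hqS, hqe⟩, t, ht, rfl⟩
        · exact absurd (arc_subset_skeleton (Set.mem_univ e)
            ⟨s, Set.Ioo_subset_Icc_self hs, rfl⟩) (hSK _ hqS)
      · rcases hq with ⟨hq, hqe⟩ | ⟨s, hs, hs'⟩
        · exact absurd (arc_subset_skeleton (Set.mem_univ e')
            ⟨t', Set.Ioo_subset_Icc_self ht', rfl⟩) hq
        · obtain rfl := h.eq_of_eq _ _ _ hs _ ht' hs'
          exact Or.inr ⟨e, he, hc, t, ht, rfl⟩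
    · obtain ⟨q, hq, hqU⟩ := mem_closure_iff.1 hz _ (hcl.isOpen_compl.pathComponentIn z)
        (mem_pathComponentIn_self hzK)
      rcases hqU with hqS | ⟨e', he', hc, t', ht', rfl⟩
      · exact Or.inl (hS q hqS z (JoinedIn.symm hq))
      · exact absurd (arc_subset_skeleton (Set.mem_univ e')
            ⟨t', Set.Ioo_subset_Icc_self ht', rfl⟩) (pathComponentIn_subset hq)
  have hsub := (isPathConnected_pathComponentIn hab.source_mem).isConnected.isPreconnected
    |>.subset_of_closure_inter_subset hopen
      ⟨a, mem_pathComponentIn_self hab.source_mem, Or.inl ha⟩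
      fun z hz => hclos ⟨hz.1, pathComponentIn_subset hz.2⟩
  rcases hsub hab with hb' | ⟨e', he', hc, t', ht', rfl⟩
  · exact hbS hb'
  · exact hb (arc_subset_skeleton (Set.mem_univ e') ⟨t', Set.Ioo_subset_Icc_self ht', rfl⟩)

theorem borders_at_most_two [Finite E] (h : IsArcSystem γ P) {e : E} {a b c : ℂ}
    (ha : a ∉ skeleton γ P Set.univ) (hb : b ∉ skeleton γ P Set.univ)
    (hc : c ∉ skeleton γ P Set.univ) (hae : Borders γ P a e) (hbe : Borders γ P b e)
    (hce : Borders γ P c e) (nab : ¬ JoinedIn (skeleton γ P Set.univ)ᶜ a b)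
    (nac : ¬ JoinedIn (skeleton γ P Set.univ)ᶜ a c)
    (nbc : ¬ JoinedIn (skeleton γ P Set.univ)ᶜ b c) : False := by
  have huniv : skeleton γ P Set.univ = skeleton γ P {e}ᶜ ∪ γ e '' Set.Icc 0 1 := by
    rw [← skeleton_insert, Set.insert_eq, Set.union_compl_self]
  have he : e ∉ ({e}ᶜ : Set E) := fun h => h rfl
  have ja := h.joinedIn_of_borders he hae
  have jb := h.joinedIn_of_borders he hbe
  have jc := h.joinedIn_of_borders he hce
  rw [huniv] at ha hb hc nab nac nbc
  exact (h.arc e).not_three_components h.isCompact_skeleton (Or.inl (h.zero_mem e))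
    (Or.inl (h.one_mem e)) (h.inter_subset_endpoints he) ha hb hc (ja.trans jb.symm)
    (ja.trans jc.symm) nab nac nbc

/-- A face boundary has no pendant arc. -/
theorem exists_ne_mem_faceBoundary [Finite E] (h : IsArcSystem γ P) {e : E} {a v : ℂ}
    (ha : a ∉ skeleton γ P Set.univ) (he : e ∈ faceBoundary γ P a) (hv : v = γ e 0 ∨ v = γ e 1) :
    ∃ e' ∈ faceBoundary γ P a, e' ≠ e ∧ (v = γ e' 0 ∨ v = γ e' 1) := by
  by_contra! hcon
  obtain ⟨hae, b, hb, hbe, nab⟩ := he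
  have hnot : ¬ JoinedIn (skeleton γ P (faceBoundary γ P a))ᶜ a b := by
    refine h.not_joinedIn_of_saturated (S := pathComponentIn (skeleton γ P Set.univ)ᶜ a)
      (fun c hc => pathComponentIn_subset hc) (fun c hc d hd => JoinedIn.trans hc hd) ?_
      (mem_pathComponentIn_self ha) hb nab
    intro e' he' c hc hce d hd hde
    by_contra hn
    exact he' ⟨hce.congr (JoinedIn.symm hc), d, hd, hde, hn⟩
  have h01 : γ e 0 ≠ γ e 1 := fun h0 => by
    simpa using (h.arc e).injOn (by norm_num) (by norm_num) h0
  obtain ⟨u, hu, huv, hends⟩ : ∃ u, (u = γ e 0 ∨ u = γ e 1) ∧ u ≠ v ∧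
      ∀ z, (z = γ e 0 ∨ z = γ e 1) → z ≠ v → z = u := by
    rcases hv with rfl | rfl
    · exact ⟨γ e 1, Or.inr rfl, h01.symm, fun z hz hne => hz.resolve_left hne⟩
    · exact ⟨γ e 0, Or.inl rfl, h01, fun z hz hne => hz.resolve_right hne⟩
  have hmem : ∀ z, (z = γ e 0 ∨ z = γ e 1) → z ∈ P ∧ z ∈ γ e '' Set.Icc 0 1 := by
    rintro z (rfl | rfl)
    · exact ⟨h.zero_mem e, 0, by norm_num, rfl⟩
    · exact ⟨h.one_mem e, 1, by norm_num, rfl⟩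
  set A : Set ℂ := (P \ {v}) ∪ ⋃ e' ∈ faceBoundary γ P a \ {e}, γ e' '' Set.Icc 0 1 with hA
  have hAs : A ⊆ skeleton γ P (faceBoundary γ P a \ {e}) :=
    Set.union_subset_union_left _ Set.sdiff_subset
  have hAc : IsCompact A :=
    h.finite.sdiff.isCompact.union ((Set.toFinite _).isCompact_biUnion fun e _ => (h.arc e).isCompact)
  have hen : e ∉ faceBoundary γ P a \ {e} := fun h => h.2 rfl
  have hvA : v ∉ A := by
    rintro (hv' | hv')
    · exact hv'.2 rfl
    · obtain ⟨e', he', hve'⟩ := Set.mem_iUnion₂.1 hv'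
      have := hcon e' he'.1 he'.2
      rcases h.mem_endpoints hve' (hmem v hv).1 with h1 | h1
      · exact this.1 h1
      · exact this.2 h1
  have hAK : A ∪ γ e '' Set.Icc 0 1 ⊆ skeleton γ P Set.univ :=
    Set.union_subset (hAs.trans (skeleton_mono (Set.subset_univ _)))
      (arc_subset_skeleton (Set.mem_univ e))
  refine hnot (((h.arc e).joinedIn_of_pendant hAc (x := u) (Or.inl ⟨(hmem u hu).1, huv⟩)
    (hmem u hu).2 ?_ (fun hm => ha (hAK hm)) (fun hm => hb (hAK hm)) ?_).mono ?_)
  · rintro z ⟨hz, hze⟩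
    exact hends z (h.inter_subset_endpoints hen ⟨hAs hz, hze⟩) fun hzv => hvA (hzv ▸ hz)
  · exact ((h.joinedIn_of_borders hen hae).trans (h.joinedIn_of_borders hen hbe).symm).mono
      (Set.compl_subset_compl.2 hAs)
  · rw [Set.compl_subset_compl]
    rintro z (hz | hz)
    · by_cases hzv : z = v
      · exact Or.inr (hzv ▸ (hmem v hv).2)
      · exact Or.inl (Or.inl ⟨hz, hzv⟩)
    · obtain ⟨e', he', hze'⟩ := Set.mem_iUnion₂.1 hz
      by_cases hee : e' = e
      · exact Or.inr (hee ▸ hze')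
      · exact Or.inl (Or.inr (Set.mem_iUnion₂.2 ⟨e', ⟨he', hee⟩, hze'⟩))

/-- Any nontrivial set of faces is separated from the other faces by some arc. -/
theorem exists_mem_faceBoundary_of_cut [Finite E] (h : IsArcSystem γ P) {T S : Set ℂ}
    (hT : ∀ a ∈ T, a ∉ skeleton γ P Set.univ)
    (hTn : ∀ a ∈ T, ∀ b ∈ T, JoinedIn (skeleton γ P Set.univ)ᶜ a b → a = b) (hST : S ⊆ T)
    (hne : S.Nonempty) (hneT : S ≠ T) :
    ∃ e, ∃ i ∈ S, e ∈ faceBoundary γ P i ∧ ∀ j ∈ S, e ∈ faceBoundary γ P j → j = i := by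
  obtain ⟨a, ha⟩ := hne
  obtain ⟨b, hbT, hbS⟩ : ∃ b ∈ T, b ∉ S := by
    by_contra! hcon
    exact hneT (hST.antisymm hcon)
  have hex : ∃ e, ∃ i ∈ S, Borders γ P i e ∧ ∃ c ∉ skeleton γ P Set.univ, Borders γ P c e ∧
      ∀ j ∈ S, ¬ JoinedIn (skeleton γ P Set.univ)ᶜ j c := by
    by_contra! hcon
    refine h.not_joinedIn_of_saturated (H := ∅)
      (S := {z | ∃ j ∈ S, JoinedIn (skeleton γ P Set.univ)ᶜ j z}) (a := a) (b := b)
      ?_ ?_ ?_ ?_ (hT b hbT) ?_ ?_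
    · rintro c ⟨j, -, hj⟩
      exact hj.target_mem
    · rintro c ⟨j, hjS, hj⟩ d hd
      exact ⟨j, hjS, hj.trans hd⟩
    · rintro e - c ⟨j, hjS, hj⟩ hce d hd hde
      exact hcon e j hjS (hce.congr hj.symm) d hd hde
    · exact ⟨a, ha, JoinedIn.refl (hT a (hST ha))⟩
    · rintro ⟨j, hjS, hj⟩
      exact hbS (hTn j (hST hjS) b hbT hj ▸ hjS)
    · have h0 : skeleton γ P ∅ = P := by simp [skeleton]
      rw [h0]
      have hP : ∀ x ∈ T, x ∈ Pᶜ := fun x hx hxP => hT x hx (Or.inl hxP)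
      refine (h.finite.countable.isPathConnected_compl_of_one_lt_rank ?_).joinedIn a
        (hP a (hST ha)) b (hP b hbT)
      rw [Complex.rank_real_complex]
      norm_num
  obtain ⟨e, i, hi, hie, c, hc, hce, hjc⟩ := hex
  refine ⟨e, i, hi, ⟨hie, c, hc, hce, hjc i hi⟩, fun j hj hje => ?_⟩
  by_contra hne
  exact h.borders_at_most_two (hT j (hST hj)) (hT i (hST hi)) hc hje.1 hie hce
    (fun hji => hne (hTn j (hST hj) i (hST hi) hji)) (hjc j hj) (hjc i hi)

/-- Each arc whose endpoints are already connected increases the number of components. -/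
theorem exists_points [Finite E] (h : IsArcSystem γ P) (H₀ : Set E)
    (hj : ∀ e ∉ H₀, JoinedIn (skeleton γ P H₀) (γ e 0) (γ e 1)) (H : Finset E)
    (hd : ∀ e ∈ H, e ∉ H₀) :
    ∃ T : Finset ℂ, H.card + 1 ≤ T.card ∧ (∀ a ∈ T, a ∉ skeleton γ P (H₀ ∪ H)) ∧
      ∀ a ∈ T, ∀ b ∈ T, JoinedIn (skeleton γ P (H₀ ∪ H))ᶜ a b → a = b := by
  classical
  induction H using Finset.induction_on with
  | empty =>
    have hcomp := h.isCompact_skeleton (H := H₀ ∪ (∅ : Finset E))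
    obtain ⟨a, ha⟩ := (Set.ne_univ_iff_exists_notMem _).1 hcomp.ne_univ
    exact ⟨{a}, by simp, by simpa using ha, by simp⟩
  | insert e H he ih =>
    obtain ⟨T, hcard, hTK, hTn⟩ := ih fun e' he' => hd e' (Finset.mem_insert_of_mem he')
    have he0 := hd e (Finset.mem_insert_self e H)
    have heH : e ∉ H₀ ∪ (H : Set E) := fun hm => hm.elim he0 (fun hm => he hm)
    have hins : skeleton γ P (H₀ ∪ (insert e H : Finset E)) =
        skeleton γ P (H₀ ∪ H) ∪ γ e '' Set.Icc 0 1 := by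
      rw [← skeleton_insert, Finset.coe_insert, Set.union_insert]
    rw [hins]
    set A := skeleton γ P (H₀ ∪ (H : Set E)) with hA
    have hdisj : Disjoint A (γ e '' Set.Ioo 0 1) := by
      rw [Set.disjoint_right]
      rintro _ ⟨t, ht, rfl⟩ hm
      exact heH (h.mem_of_mem_skeleton ht hm)
    obtain ⟨a, b, ha, hb, hma, hmb, hab⟩ := (h.arc e).exists_separated
      h.isCompact_skeleton.isClosed hdisj ((hj e he0).mono (skeleton_mono Set.subset_union_left))
    have hsub : (A ∪ γ e '' Set.Icc 0 1)ᶜ ⊆ Aᶜ := Set.compl_subset_compl.2 Set.subset_union_left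
    set T₁ := T.filter fun z => ¬ JoinedIn Aᶜ (γ e (1 / 2)) z with hT₁
    have hT1c : T.card ≤ T₁.card + 1 := by
      have h1 : (T.filter fun z => JoinedIn Aᶜ (γ e (1 / 2)) z).card + T₁.card = T.card := by
        convert! Finset.card_filter_add_card_filter_not (s := T) _
      have h2 : (T.filter fun z => JoinedIn Aᶜ (γ e (1 / 2)) z).card ≤ 1 := by
        rw [Finset.card_le_one]
        intro x hx y hy
        rw [Finset.mem_filter] at hx hy
        exact hTn x hx.1 y hy.1 (hx.2.symm.trans hy.2)
      omega
    have haT : a ∉ T₁ := fun hm => (Finset.mem_filter.1 hm).2 hma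
    have hbT : b ∉ T₁ := fun hm => (Finset.mem_filter.1 hm).2 hmb
    have hne : a ≠ b := fun hne => hab (hne ▸ JoinedIn.refl ha)
    have hT1K : ∀ z ∈ T₁, z ∉ A ∪ γ e '' Set.Icc 0 1 := by
      intro z hz hzm
      rw [hT₁, Finset.mem_filter] at hz
      rcases hzm with hzm | hzm
      · exact hTK z hz.1 hzm
      · obtain ⟨t, ht, rfl⟩ := (h.mem_or_mem_Ioo hzm).resolve_left
          fun hP => hTK z hz.1 (Or.inl hP)
        exact hz.2 (h.joinedIn_arc heH (by norm_num) ht)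
    refine ⟨insert a (insert b T₁), ?_, ?_, ?_⟩
    · have haT' : a ∉ insert b T₁ := by simp [hne, haT]
      rw [Finset.card_insert_of_notMem haT', Finset.card_insert_of_notMem hbT,
        Finset.card_insert_of_notMem he]
      omega
    · intro z hz
      rw [Finset.mem_insert, Finset.mem_insert] at hz
      rcases hz with rfl | rfl | hz
      exacts [ha, hb, hT1K z hz]
    · have key : ∀ z ∈ T₁, ∀ c, JoinedIn Aᶜ (γ e (1 / 2)) c → ¬ JoinedIn Aᶜ c z :=
        fun z hz c hc hcz => (Finset.mem_filter.1 hz).2 (hc.trans hcz)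
      intro x hx y hy hxy
      have hxy' := hxy.mono hsub
      rw [Finset.mem_insert, Finset.mem_insert] at hx hy
      rcases hx with rfl | rfl | hx <;> rcases hy with rfl | rfl | hy
      · rfl
      · exact absurd hxy hab
      · exact absurd hxy' (key y hy _ hma)
      · exact absurd hxy.symm hab
      · rfl
      · exact absurd hxy' (key y hy _ hmb)
      · exact absurd hxy'.symm (key x hx _ hma)
      · exact absurd hxy'.symm (key x hx _ hmb)
      · exact hTn x (Finset.mem_filter.1 hx).1 y (Finset.mem_filter.1 hy).1 hxy'

end IsArcSystem

/-- The combinatorial properties of the family of face boundaries `F` of a plane drawing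
of `G`. A bridge of `G` belongs to no face boundary. -/
structure SimpleGraph.IsFaceSystem {V ι : Type*} [Fintype V] [Fintype ι] (G : SimpleGraph V)
    (F : ι → Finset (Sym2 V)) : Prop where
  mem_edgeSet : ∀ i, ∀ e ∈ F i, e ∈ G.edgeSet
  card_le : G.edgeSet.ncard + 2 ≤ Fintype.card V + Fintype.card ι
  at_most_two : ∀ e i j k, e ∈ F i → e ∈ F j → e ∈ F k → i = j ∨ i = k ∨ j = k
  exists_ne : ∀ i, ∀ e ∈ F i, ∀ v ∈ e, ∃ e' ∈ F i, e' ≠ e ∧ v ∈ e'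
  exists_cut : ∀ S : Set ι, S.Nonempty → S ≠ Set.univ →
    ∃ e, ∃ i ∈ S, e ∈ F i ∧ ∀ j ∈ S, e ∈ F j → j = i

theorem SimpleGraph.IsAcyclic.ncard_edgeSet_lt {V : Type*} [Fintype V] [Nonempty V]
    {F : SimpleGraph V} (hF : F.IsAcyclic) : F.edgeSet.ncard + 1 ≤ Fintype.card V := by
  classical
  obtain ⟨T, hFT, -, hT⟩ :=
    (connected_top (V := V)).exists_isTree_le_of_le_of_isAcyclic le_top hF
  rw [← hT.card_edgeFinset, add_le_add_iff_right, ← Set.ncard_coe_finset, coe_edgeFinset]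
  exact Set.ncard_le_ncard (edgeSet_mono hFT) (Set.toFinite _)

theorem SimpleGraph.HasPlanarEmbedding.exists_isArcSystem {V : Type*} [Finite V]
    {G : SimpleGraph V} (hG : G.HasPlanarEmbedding) :
    ∃ (pos : V → ℂ) (γ : G.edgeSet → ℝ → ℂ), Function.Injective pos ∧
      IsArcSystem γ (Set.range pos) ∧ ∀ e : G.edgeSet, ∃ u v, e.1 = s(u, v) ∧
        γ e 0 = pos u ∧ γ e 1 = pos v := by
  obtain ⟨pos, arc, hpos, harc, hdisj⟩ := hG
  have hinj : Function.Injective Complex.equivRealProdCLM.symm :=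
    Complex.equivRealProdCLM.symm.injective
  have hout : ∀ e : G.edgeSet, s((Quot.out e.1).1, (Quot.out e.1).2) = e.1 :=
    fun e => Quot.out_eq e.1
  have hadj : ∀ e : G.edgeSet, G.Adj (Quot.out e.1).1 (Quot.out e.1).2 := fun e => by
    rw [← mem_edgeSet, hout]
    exact e.2
  refine ⟨fun v => Complex.equivRealProdCLM.symm (pos v),
    fun e t => Complex.equivRealProdCLM.symm (arc (Quot.out e.1).1 (Quot.out e.1).2 t),
    hinj.comp hpos, ⟨Set.finite_range _, ?_, ?_, ?_, ?_, ?_⟩, ?_⟩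
  · intro e
    obtain ⟨hc, hi, -⟩ := harc _ _ (hadj e)
    exact ⟨Complex.equivRealProdCLM.symm.continuous.comp_continuousOn hc, hinj.comp_injOn hi⟩
  · intro e
    obtain ⟨-, -, h0, -⟩ := harc _ _ (hadj e)
    exact ⟨(Quot.out e.1).1, by rw [h0]⟩
  · intro e
    obtain ⟨-, -, -, h1, -⟩ := harc _ _ (hadj e)
    exact ⟨(Quot.out e.1).2, by rw [h1]⟩
  · rintro e t ht ⟨w, hw⟩
    obtain ⟨-, -, -, -, -, hP⟩ := harc _ _ (hadj e)
    exact hP w t ht (hinj hw).symm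
  · intro e e' t ht t' ht' he
    by_contra hne
    refine hdisj _ _ _ _ (hadj e) (hadj e') ?_ t ht t' ht' (hinj he)
    rw [hout, hout]
    exact fun h => hne (Subtype.ext h)
  · intro e
    obtain ⟨-, -, h0, h1, -⟩ := harc _ _ (hadj e)
    exact ⟨_, _, (hout e).symm, congrArg _ h0, congrArg _ h1⟩

theorem SimpleGraph.HasPlanarEmbedding.exists_isFaceSystem {V : Type*} [Fintype V] [Nonempty V]
    {G : SimpleGraph V} (hG : G.HasPlanarEmbedding) :
    ∃ (T : Finset ℂ) (F : T → Finset (Sym2 V)), G.IsFaceSystem F := by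
  classical
  obtain ⟨pos, γ, hpos, h, hends⟩ := hG.exists_isArcSystem
  have hv : ∀ (e : G.edgeSet) (v : V), v ∈ e.1 ↔ pos v = γ e 0 ∨ pos v = γ e 1 := by
    intro e v
    obtain ⟨x, y, he, h0, h1⟩ := hends e
    rw [he, h0, h1, Sym2.mem_iff, hpos.eq_iff, hpos.eq_iff]
  obtain ⟨F₀, hF₀G, hF₀, hreach⟩ := G.exists_isAcyclic_reachable_eq_le
  set H₀ : Set G.edgeSet := {e | e.1 ∈ F₀.edgeSet} with hH₀
  have hadj : ∀ u v, F₀.Adj u v → JoinedIn (skeleton γ (Set.range pos) H₀) (pos u) (pos v) := by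
    intro u v huv
    have heG : s(u, v) ∈ G.edgeSet := hF₀G huv
    have hpc : IsPathConnected (γ ⟨s(u, v), heG⟩ '' Set.Icc 0 1) :=
      ((convex_Icc 0 1).isPathConnected ⟨0, by norm_num⟩).image' (h.arc _).continuousOn
    have hmem : ∀ w ∈ s(u, v), pos w ∈ γ ⟨s(u, v), heG⟩ '' Set.Icc 0 1 := by
      intro w hw
      rcases (hv ⟨s(u, v), heG⟩ w).1 hw with hw | hw
      · exact ⟨0, by norm_num, hw.symm⟩
      · exact ⟨1, by norm_num, hw.symm⟩
    exact (hpc.joinedIn _ (hmem u (by simp)) _ (hmem v (by simp))).mono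
      (arc_subset_skeleton (H := H₀) (e := ⟨s(u, v), heG⟩) huv)
  have hjoin : ∀ u v, F₀.Reachable u v →
      JoinedIn (skeleton γ (Set.range pos) H₀) (pos u) (pos v) := by
    rintro u v ⟨p⟩
    induction p with
    | nil => exact JoinedIn.refl (Or.inl ⟨_, rfl⟩)
    | cons hadj' _ ih => exact (hadj _ _ hadj').trans ih
  obtain ⟨T, hcard, hTK, hTn⟩ := h.exists_points H₀ (fun e _ => by
    obtain ⟨u, v, he, h0, h1⟩ := hends e
    rw [h0, h1]
    refine hjoin u v ?_
    rw [hreach]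
    exact Adj.reachable (G.mem_edgeSet.1 (he ▸ e.2))) H₀.toFinsetᶜ (fun e he => by simpa using he)
  have huniv : H₀ ∪ ((H₀.toFinsetᶜ : Finset G.edgeSet) : Set G.edgeSet) = Set.univ := by
    simp
  rw [huniv] at hTK hTn
  refine ⟨T, fun i => (Subtype.val '' faceBoundary γ (Set.range pos) i.1).toFinset, ?_⟩
  have hmemF : ∀ (e : Sym2 V) (i : ℂ),
      e ∈ (Subtype.val '' faceBoundary γ (Set.range pos) i).toFinset ↔
        ∃ he : e ∈ G.edgeSet, (⟨e, he⟩ : G.edgeSet) ∈ faceBoundary γ (Set.range pos) i := by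
    intro e i
    simp
  constructor
  · intro i e he
    exact ((hmemF _ _).1 he).1
  · rw [Fintype.card_coe]
    have h1 := hF₀.ncard_edgeSet_lt
    have h2 : H₀.toFinset.card = F₀.edgeSet.ncard := by
      rw [← Set.ncard_eq_toFinset_card', ← Set.ncard_image_of_injective H₀ Subtype.val_injective]
      congr 1
      ext e
      simp only [hH₀, Set.mem_image, Set.mem_ofPred_eq, Subtype.exists, exists_and_left,
        exists_prop, exists_eq_right_right, and_iff_left_iff_imp]
      exact fun he => edgeSet_mono hF₀G he
    have h3 : G.edgeSet.ncard = Fintype.card G.edgeSet := by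
      rw [Set.ncard_eq_toFinset_card', Set.toFinset_card]
    have h4 := Finset.card_add_card_compl H₀.toFinset
    omega
  · intro e i j k hi hj hk
    obtain ⟨he, hi⟩ := (hmemF _ _).1 hi
    obtain ⟨_, hj⟩ := (hmemF _ _).1 hj
    obtain ⟨_, hk⟩ := (hmemF _ _).1 hk
    by_contra! hcon
    exact h.borders_at_most_two (hTK _ i.2) (hTK _ j.2) (hTK _ k.2) hi.1 hj.1 hk.1
      (fun hn => hcon.1 (Subtype.ext (hTn _ i.2 _ j.2 hn)))
      (fun hn => hcon.2.1 (Subtype.ext (hTn _ i.2 _ k.2 hn)))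
      (fun hn => hcon.2.2 (Subtype.ext (hTn _ j.2 _ k.2 hn)))
  · intro i e he v hve
    obtain ⟨he, hi⟩ := (hmemF _ _).1 he
    obtain ⟨e', he', hne, hv'⟩ := h.exists_ne_mem_faceBoundary (hTK _ i.2) hi ((hv ⟨e, he⟩ v).1 hve)
    exact ⟨e'.1, (hmemF _ _).2 ⟨e'.2, he'⟩, fun hn => hne (Subtype.ext hn), (hv e' v).2 hv'⟩
  · intro S hS hSu
    obtain ⟨e, _, ⟨i, hi, rfl⟩, hie, huniq⟩ := h.exists_mem_faceBoundary_of_cut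
      (T := (T : Set ℂ)) (S := Subtype.val '' S) hTK hTn
      (by rintro _ ⟨i, -, rfl⟩; exact i.2) (hS.image _) (by
        intro hn
        refine hSu (Set.eq_univ_of_forall fun i => ?_)
        have : i.1 ∈ Subtype.val '' S := hn ▸ i.2
        simpa using this)
    refine ⟨e.1, i, hi, (hmemF _ _).2 ⟨e.2, hie⟩, fun j hj hje => Subtype.ext ?_⟩
    exact huniq _ ⟨j, hj, rfl⟩ ((hmemF _ _).1 hje).2

theorem containsCopy_theta5 {V : Type*} {G : SimpleGraph V} {a b c d e : V}
    (hnodup : [a, b, c, d, e].Nodup) (hab : G.Adj a b) (hbc : G.Adj b c) (hcd : G.Adj c d)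
    (hde : G.Adj d e) (hae : G.Adj a e) (hac : G.Adj a c) : ContainsCopy theta5 G := by
  refine ⟨⟨[a, b, c, d, e].get, ?_⟩, List.nodup_iff_injective_get.1 hnodup⟩
  intro i j hij
  rw [theta5, fromEdgeSet_adj] at hij
  obtain ⟨hij, -⟩ := hij
  simp only [Set.mem_insert_iff, Set.mem_singleton_iff, Sym2.eq_iff] at hij
  rcases hij with (⟨rfl, rfl⟩ | ⟨rfl, rfl⟩) | (⟨rfl, rfl⟩ | ⟨rfl, rfl⟩) |
    (⟨rfl, rfl⟩ | ⟨rfl, rfl⟩) | (⟨rfl, rfl⟩ | ⟨rfl, rfl⟩) | (⟨rfl, rfl⟩ | ⟨rfl, rfl⟩) |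
    (⟨rfl, rfl⟩ | ⟨rfl, rfl⟩)
  exacts [hab, hab.symm, hbc, hbc.symm, hcd, hcd.symm, hde, hde.symm, hae, hae.symm, hac, hac.symm]

theorem Finset.coe_ne_univ_of_card_lt {ι : Type*} [Fintype ι] {S : Finset ι}
    (h : S.card < Fintype.card ι) : (S : Set ι) ≠ Set.univ := by
  rw [← Finset.coe_univ, Ne, Finset.coe_inj]
  rintro rfl
  exact h.ne rfl

namespace SimpleGraph.IsFaceSystem

variable {V ι : Type*} [Fintype V] [Fintype ι] {G : SimpleGraph V} {F : ι → Finset (Sym2 V)}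

theorem adj (h : G.IsFaceSystem F) {i : ι} {a b : V} (he : s(a, b) ∈ F i) : G.Adj a b :=
  h.mem_edgeSet i _ he

theorem exists_other_neighbor (h : G.IsFaceSystem F) {i : ι} {a b : V} (he : s(a, b) ∈ F i) :
    ∃ c, s(b, c) ∈ F i ∧ c ≠ a ∧ c ≠ b := by
  obtain ⟨e', he', hne, hb⟩ := h.exists_ne i _ he b (by simp)
  obtain ⟨c, rfl⟩ := Sym2.mem_iff_exists.1 hb
  refine ⟨c, he', ?_, (h.adj he').ne'⟩
  rintro rfl
  exact hne Sym2.eq_swap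

theorem three_le_card [Nontrivial ι] (h : G.IsFaceSystem F) (i : ι) : 3 ≤ (F i).card := by
  classical
  obtain ⟨e, j, hj, he, -⟩ := h.exists_cut {i} ⟨i, rfl⟩ (Set.singleton_ne_univ i)
  rw [Set.mem_singleton_iff.1 hj] at he
  induction e with
  | _ a b =>
    obtain ⟨c, hbc, hca, hcb⟩ := h.exists_other_neighbor he
    obtain ⟨d, had, hdb, hda⟩ := h.exists_other_neighbor (Sym2.eq_swap ▸ he)
    have hab := (h.adj he).ne
    have hsub : ({s(a, b), s(b, c), s(a, d)} : Finset (Sym2 V)) ⊆ F i := by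
      intro x hx
      simp only [Finset.mem_insert, Finset.mem_singleton] at hx
      rcases hx with rfl | rfl | rfl <;> assumption
    refine le_trans (le_of_eq ?_) (Finset.card_le_card hsub)
    rw [Finset.card_eq_three.2 ⟨_, _, _, ?_, ?_, ?_, rfl⟩] <;>
      simp only [ne_eq, Sym2.eq_iff] <;> grind

theorem exists_triangle [DecidableEq V] (h : G.IsFaceSystem F) {i : ι} {a b : V}
    (he : s(a, b) ∈ F i) (hcard : (F i).card = 3) :
    ∃ c, F i = {s(a, b), s(b, c), s(c, a)} ∧ c ≠ a ∧ c ≠ b := by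
  obtain ⟨c, hbc, hca, hcb⟩ := h.exists_other_neighbor he
  obtain ⟨d, had, hdb, hda⟩ := h.exists_other_neighbor (Sym2.eq_swap ▸ he)
  have hab := (h.adj he).ne
  have hsub : ({s(a, b), s(b, c), s(a, d)} : Finset (Sym2 V)) ⊆ F i := by
    intro x hx
    simp only [Finset.mem_insert, Finset.mem_singleton] at hx
    rcases hx with rfl | rfl | rfl <;> assumption
  have hc3 : ({s(a, b), s(b, c), s(a, d)} : Finset (Sym2 V)).card = 3 := by
    rw [Finset.card_eq_three.2 ⟨_, _, _, ?_, ?_, ?_, rfl⟩] <;>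
      simp only [ne_eq, Sym2.eq_iff] <;> grind
  have heq := Finset.eq_of_subset_of_card_le hsub (by omega)
  obtain ⟨x, hx, hxb, hxc⟩ := h.exists_other_neighbor hbc
  have hxd : c = d := by
    rw [← heq] at hx
    simp only [Finset.mem_insert, Finset.mem_singleton, Sym2.eq_iff] at hx
    grind
  subst hxd
  exact ⟨c, by rw [← heq, Sym2.eq_swap (a := c)], hca, hcb⟩

theorem exists_quadrilateral [DecidableEq V] (h : G.IsFaceSystem F) {i : ι} {a b : V}
    (he : s(a, b) ∈ F i) (hcard : (F i).card = 4) :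
    ∃ c d, s(b, c) ∈ F i ∧ s(c, d) ∈ F i ∧ s(d, a) ∈ F i ∧ c ≠ a ∧ d ≠ b := by
  obtain ⟨c, hbc, hca, hcb⟩ := h.exists_other_neighbor he
  obtain ⟨d, had, hdb, hda⟩ := h.exists_other_neighbor (Sym2.eq_swap ▸ he)
  have hab := (h.adj he).ne
  refine ⟨c, d, hbc, ?_, Sym2.eq_swap ▸ had, hca, hdb⟩
  have hsub : ({s(a, b), s(b, c), s(a, d)} : Finset (Sym2 V)) ⊆ F i := by
    intro x hx
    simp only [Finset.mem_insert, Finset.mem_singleton] at hx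
    rcases hx with rfl | rfl | rfl <;> assumption
  have hc3 : ({s(a, b), s(b, c), s(a, d)} : Finset (Sym2 V)).card = 3 := by
    rw [Finset.card_eq_three.2 ⟨_, _, _, ?_, ?_, ?_, rfl⟩] <;>
      simp only [ne_eq, Sym2.eq_iff] <;> grind
  obtain ⟨x, hx3, hxF⟩ := Finset.exists_eq_insert_iff.2 ⟨hsub, by omega⟩
  have hmem : ∀ y, y ∈ F i ↔ y = x ∨ y = s(a, b) ∨ y = s(b, c) ∨ y = s(a, d) := by
    intro y
    simp [← hxF]
  induction x with
  | _ p q =>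
    have hpq : s(p, q) ∈ F i := (hmem _).2 (Or.inl rfl)
    have hpq' := (h.adj hpq).ne
    by_cases hcd : c = d
    · subst hcd
      obtain ⟨r, hr, hrp, hrq⟩ := h.exists_other_neighbor hpq
      obtain ⟨r', hr', hrp', hrq'⟩ := h.exists_other_neighbor (Sym2.eq_swap ▸ hpq)
      rw [hmem] at hr hr'
      simp only [Finset.mem_insert, Finset.mem_singleton, Sym2.eq_iff] at hr hr' hx3
      grind
    · obtain ⟨r, hr, hrp, hrq⟩ := h.exists_other_neighbor hbc
      obtain ⟨r', hr', hrp', hrq'⟩ := h.exists_other_neighbor had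
      rw [hmem] at hr hr' ⊢
      simp only [Sym2.eq_iff] at hr hr' ⊢
      grind

theorem injective (h : G.IsFaceSystem F) (hι : 5 ≤ Fintype.card ι) : Function.Injective F := by
  classical
  intro i j hij
  by_contra hne
  have huniv : ((({i, j} : Finset ι)) : Set ι) ≠ Set.univ := by
    have hc : ({i, j} : Finset ι).card ≤ 2 := Finset.card_le_two
    exact Finset.coe_ne_univ_of_card_lt (by omega)
  obtain ⟨e, k, hk, hek, hu⟩ := h.exists_cut _ ⟨i, by simp⟩ huniv
  have hi : e ∈ F i := by
    simp only [Finset.coe_insert, Finset.coe_singleton, Set.mem_insert_iff,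
      Set.mem_singleton_iff] at hk
    rcases hk with rfl | rfl
    · exact hek
    · exact hij ▸ hek
  exact hne ((hu i (by simp) hi).trans (hu j (by simp) (hij ▸ hi)).symm)

/-- A triangular face two of whose edges are on other triangular faces is not adjacent to a
third face of size three or four. -/
theorem false_of_triangle [DecidableEq V] (h : G.IsFaceSystem F) (hι : 5 ≤ Fintype.card ι)
    (hfree : ¬ ContainsCopy theta5 G) {t t₁ t₂ t₃ : ι} {a b c : V}
    (hab : a ≠ b) (hca : c ≠ a) (hcb : c ≠ b)
    (ht : F t = {s(a, b), s(b, c), s(c, a)}) (h1 : t₁ ≠ t) (h2 : t₂ ≠ t) (h3 : t₃ ≠ t)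
    (hab₁ : s(a, b) ∈ F t₁) (hbc₂ : s(b, c) ∈ F t₂) (hca₃ : s(c, a) ∈ F t₃)
    (hc₁ : (F t₁).card = 3) (hc₂ : (F t₂).card = 3)
    (hc₃ : (F t₃).card = 3 ∨ (F t₃).card = 4) : False := by
  have hinj := h.injective hι
  have abt : s(a, b) ∈ F t := by simp [ht]
  have bct : s(b, c) ∈ F t := by simp [ht]
  have cat : s(c, a) ∈ F t := by simp [ht]
  have Aab := h.adj abt
  have Abc := h.adj bct
  have Aca := h.adj cat
  rcases hc₃ with hc₃ | hc₃
  · obtain ⟨d, hd, hda, hdb⟩ := h.exists_triangle hab₁ hc₁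
    obtain ⟨e, he, heb, hec⟩ := h.exists_triangle hbc₂ hc₂
    obtain ⟨f, hf, hfc, hfa⟩ := h.exists_triangle hca₃ hc₃
    have hdc : d ≠ c := fun hdc => h1 (hinj (by rw [hd, ht, hdc]))
    have hea : e ≠ a := fun hea => h2 (hinj (by
      rw [he, ht, hea]
      ext x
      simp only [Finset.mem_insert, Finset.mem_singleton]
      tauto))
    have hfb : f ≠ b := fun hfb => h3 (hinj (by
      rw [hf, ht, hfb]
      ext x
      simp only [Finset.mem_insert, Finset.mem_singleton]
      tauto))
    have Abd : G.Adj b d := h.adj (i := t₁) (by simp [hd])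
    have Ada : G.Adj d a := h.adj (i := t₁) (by simp [hd])
    have Ace : G.Adj c e := h.adj (i := t₂) (by simp [he])
    have Aeb : G.Adj e b := h.adj (i := t₂) (by simp [he])
    have Aaf : G.Adj a f := h.adj (i := t₃) (by simp [hf])
    have Afc : G.Adj f c := h.adj (i := t₃) (by simp [hf])
    have hde : d = e := by
      by_contra hde
      exact hfree (containsCopy_theta5 (a := a) (b := d) (c := b) (d := e) (e := c)
        (by simp; grind) Ada.symm Abd.symm Aeb.symm Ace.symm Aca.symm Aab)
    subst hde
    have hfd : f = d := by
      by_contra hfd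
      exact hfree (containsCopy_theta5 (a := a) (b := f) (c := c) (d := d) (e := b)
        (by simp; grind) Aaf Afc Ace Abd.symm Aab Aca.symm)
    subst hfd
    classical
    have huniv : ((({t, t₁, t₂, t₃} : Finset ι)) : Set ι) ≠ Set.univ := by
      have hc : ({t, t₁, t₂, t₃} : Finset ι).card ≤ 4 := Finset.card_le_four
      exact Finset.coe_ne_univ_of_card_lt (by omega)
    have h12 : t₁ ≠ t₂ := by
      rintro rfl
      rw [he] at hab₁
      simp only [Finset.mem_insert, Finset.mem_singleton, Sym2.eq_iff] at hab₁
      grind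
    have h13 : t₁ ≠ t₃ := by
      rintro rfl
      rw [hf] at hab₁
      simp only [Finset.mem_insert, Finset.mem_singleton, Sym2.eq_iff] at hab₁
      grind
    have h23 : t₂ ≠ t₃ := by
      rintro rfl
      rw [hf] at hbc₂
      simp only [Finset.mem_insert, Finset.mem_singleton, Sym2.eq_iff] at hbc₂
      grind
    obtain ⟨x, k, hk, hxk, hu⟩ := h.exists_cut _ ⟨t, by simp⟩ huniv
    have hu0 := hu t (by simp)
    have hu1 := hu t₁ (by simp)
    have hu2 := hu t₂ (by simp)
    have hu3 := hu t₃ (by simp)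
    rw [Sym2.eq_swap (a := f) (b := a)] at hd
    rw [Sym2.eq_swap (a := f) (b := b)] at he
    rw [Sym2.eq_swap (a := f) (b := c)] at hf
    rw [ht] at hu0
    rw [hd] at hu1
    rw [he] at hu2
    rw [hf] at hu3
    have e1 : x ≠ s(a, b) := by
      rintro rfl
      exact h1 ((hu1 (by simp)).trans (hu0 (by simp)).symm)
    have e2 : x ≠ s(b, c) := by
      rintro rfl
      exact h2 ((hu2 (by simp)).trans (hu0 (by simp)).symm)
    have e3 : x ≠ s(c, a) := by
      rintro rfl
      exact h3 ((hu3 (by simp)).trans (hu0 (by simp)).symm)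
    have e4 : x ≠ s(b, f) := by
      rintro rfl
      exact h12 ((hu1 (by simp)).trans (hu2 (by simp)).symm)
    have e5 : x ≠ s(a, f) := by
      rintro rfl
      exact h13 ((hu1 (by simp)).trans (hu3 (by simp)).symm)
    have e6 : x ≠ s(c, f) := by
      rintro rfl
      exact h23 ((hu2 (by simp)).trans (hu3 (by simp)).symm)
    have hFk : F k = F t ∨ F k = F t₁ ∨ F k = F t₂ ∨ F k = F t₃ := by
      simp only [Finset.coe_insert, Finset.coe_singleton, Set.mem_insert_iff,
        Set.mem_singleton_iff] at hk
      rcases hk with rfl | rfl | rfl | rfl <;> simp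
    rw [ht, hd, he, hf] at hFk
    rcases hFk with hFk | hFk | hFk | hFk <;> rw [hFk] at hxk <;>
      simp only [Finset.mem_insert, Finset.mem_singleton, e1, e2, e3, e4, e5, e6, or_self] at hxk
  · obtain ⟨y, x, hay, hyx, hxc, hyc, hxa⟩ := h.exists_quadrilateral hca₃ hc₃
    have hyb : y ≠ b := by
      rintro rfl
      rcases h.at_most_two _ _ _ _ abt hab₁ hay with h' | h' | h'
      · exact h1 h'.symm
      · exact h3 h'.symm
      · rw [h'] at hc₁
        omega
    have hxb : x ≠ b := by
      rintro rfl
      rcases h.at_most_two _ _ _ _ bct hbc₂ hxc with h' | h' | h'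
      · exact h2 h'.symm
      · exact h3 h'.symm
      · rw [h'] at hc₂
        omega
    have Aay := h.adj hay
    have Ayx := h.adj hyx
    have Axc := h.adj hxc
    have n1 := Aay.ne
    have n2 := Ayx.ne
    have n3 := Axc.ne
    exact hfree (containsCopy_theta5 (a := c) (b := b) (c := a) (d := y) (e := x)
      (by simp; grind) Abc.symm Aab.symm Aay Ayx Axc.symm Aca)

end SimpleGraph.IsFaceSystem

/-- The weight of a face of size `k` in the discharging argument. -/
def faceWeight (k : ℕ) : ℕ := if k = 3 then 0 else if k = 4 then 1 else 2

/-- The total weight of an edge `e`: that of the faces it belongs to, plus two for each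
missing face. -/
def edgeWeight {ι α : Type*} [Fintype ι] [DecidableEq α] (F : ι → Finset α) (e : α) : ℕ :=
  ∑ j with e ∈ F j, faceWeight (F j).card + 2 * (2 - (Finset.univ.filter fun j => e ∈ F j).card)

theorem exists_ne_of_edgeWeight_le_one {ι α : Type*} [Fintype ι] [DecidableEq α]
    {F : ι → Finset α} {e : α} (t : ι) (hw : edgeWeight F e ≤ 1) :
    ∃ t' ≠ t, e ∈ F t' ∧ faceWeight (F t').card ≤ edgeWeight F e := by
  classical
  rw [edgeWeight] at hw ⊢
  have hcard : 1 < (Finset.univ.filter fun j => e ∈ F j).card := by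
    by_contra! hle
    omega
  obtain ⟨t', ht', hne⟩ := Finset.exists_mem_ne hcard t
  refine ⟨t', hne, (Finset.mem_filter.1 ht').2, le_trans ?_ (Nat.le_add_right _ _)⟩
  exact Finset.single_le_sum (f := fun j => faceWeight (F j).card) (fun _ _ => Nat.zero_le _) ht'

namespace SimpleGraph.IsFaceSystem

variable {V ι : Type*} [Fintype V] [Fintype ι] [DecidableEq V] {G : SimpleGraph V}
  {F : ι → Finset (Sym2 V)}

theorem card_filter_mem_le_two (h : G.IsFaceSystem F) (e : Sym2 V) :
    (Finset.univ.filter fun j => e ∈ F j).card ≤ 2 := by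
  by_contra! hlt
  obtain ⟨i, hi, j, hj, k, hk, hij, hik, hjk⟩ := Finset.two_lt_card.1 hlt
  simp only [Finset.mem_filter, Finset.mem_univ, true_and] at hi hj hk
  rcases h.at_most_two e i j k hi hj hk with h' | h' | h' <;> contradiction

theorem two_le_sum_edgeWeight (h : G.IsFaceSystem F) (hι : 5 ≤ Fintype.card ι)
    (hfree : ¬ ContainsCopy theta5 G) {t : ι} (ht : (F t).card = 3) :
    2 ≤ ∑ e ∈ F t, edgeWeight F e := by
  have : Nontrivial ι := Fintype.one_lt_card_iff_nontrivial.1 (by omega)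
  have key : ∀ a b c : V, a ≠ b → c ≠ a → c ≠ b → F t = {s(a, b), s(b, c), s(c, a)} →
      edgeWeight F s(a, b) = 0 → edgeWeight F s(b, c) = 0 → edgeWeight F s(c, a) ≤ 1 → False := by
    intro a b c hab hca hcb hF h1 h2 h3
    obtain ⟨t₁, n1, m1, w1⟩ := exists_ne_of_edgeWeight_le_one (F := F) (e := s(a, b)) t (by omega)
    obtain ⟨t₂, n2, m2, w2⟩ := exists_ne_of_edgeWeight_le_one (F := F) (e := s(b, c)) t (by omega)
    obtain ⟨t₃, n3, m3, w3⟩ := exists_ne_of_edgeWeight_le_one (F := F) (e := s(c, a)) t h3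
    refine h.false_of_triangle hι hfree hab hca hcb hF n1 n2 n3 m1 m2 m3 ?_ ?_ ?_ <;>
      grind [faceWeight]
  obtain ⟨e, he⟩ := Finset.card_pos.1 (by omega : 0 < (F t).card)
  induction e with
  | _ a b =>
    have hab := (h.adj he).ne
    obtain ⟨c, hF, hca, hcb⟩ := h.exists_triangle he ht
    have hsum : ∑ e ∈ F t, edgeWeight F e =
        edgeWeight F s(a, b) + (edgeWeight F s(b, c) + edgeWeight F s(c, a)) := by
      rw [hF, Finset.sum_insert, Finset.sum_pair] <;>
        simp only [ne_eq, Finset.mem_insert, Finset.mem_singleton, Sym2.eq_iff] <;> grind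
    have hF' : F t = {s(b, c), s(c, a), s(a, b)} := by
      rw [hF]
      ext x
      simp only [Finset.mem_insert, Finset.mem_singleton]
      tauto
    have hF'' : F t = {s(c, a), s(a, b), s(b, c)} := by
      rw [hF]
      ext x
      simp only [Finset.mem_insert, Finset.mem_singleton]
      tauto
    have k1 := key a b c hab hca hcb hF
    have k2 := key b c a hcb.symm hab hca.symm hF'
    have k3 := key c a b hca hcb.symm hab.symm hF''
    by_contra! hlt
    rw [hsum] at hlt
    by_cases h1 : edgeWeight F s(a, b) = 0
    · by_cases h2 : edgeWeight F s(b, c) = 0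
      · exact k1 h1 h2 (by omega)
      · exact k3 (by omega) h1 (by omega)
    · exact k2 (by omega) (by omega) (by omega)

theorem card_mul_edgeWeight_le (h : G.IsFaceSystem F) (e : Sym2 V) :
    (Finset.univ.filter fun t => (F t).card = 3 ∧ e ∈ F t).card * edgeWeight F e ≤
      edgeWeight F e := by
  have hsub : (Finset.univ.filter fun t => (F t).card = 3 ∧ e ∈ F t) ⊆
      Finset.univ.filter fun j => e ∈ F j := fun j => by
    simp only [Finset.mem_filter, Finset.mem_univ, true_and]
    exact fun hj => hj.2
  rcases le_or_gt (Finset.univ.filter fun t => (F t).card = 3 ∧ e ∈ F t).card 1 with hle | hlt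
  · exact (Nat.mul_le_mul_right _ hle).trans_eq (one_mul _)
  · have h2 := h.card_filter_mem_le_two e
    have heq := Finset.eq_of_subset_of_card_le hsub (by omega)
    have h0 : edgeWeight F e = 0 := by
      rw [edgeWeight, ← heq, Finset.sum_eq_zero, zero_add]
      · omega
      · intro j hj
        simp [faceWeight, (Finset.mem_filter.1 hj).2.1]
    rw [h0, mul_zero]

theorem five_mul_card_le (h : G.IsFaceSystem F) (hι : 5 ≤ Fintype.card ι)
    (hfree : ¬ ContainsCopy theta5 G) : 5 * Fintype.card ι ≤ 3 * G.edgeSet.ncard := by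
  classical
  have : Nontrivial ι := Fintype.one_lt_card_iff_nontrivial.1 (by omega)
  have hmem : ∀ i, ∀ e ∈ F i, e ∈ G.edgeFinset := fun i e he => mem_edgeFinset.2 (h.mem_edgeSet i e he)
  have hncard : G.edgeSet.ncard = G.edgeFinset.card := by
    rw [← Set.ncard_coe_finset, coe_edgeFinset]
  have hdeg : ∑ e ∈ G.edgeFinset, (Finset.univ.filter fun j => e ∈ F j).card =
      ∑ j, (F j).card := by
    simp only [Finset.card_eq_sum_ones]
    exact Finset.sum_comm' fun e j => by simpa using hmem j e
  have hdeg2 : ∑ j, (F j).card ≤ 2 * G.edgeFinset.card := by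
    rw [← hdeg, mul_comm, ← smul_eq_mul]
    exact Finset.sum_le_card_nsmul _ _ _ fun e _ => h.card_filter_mem_le_two e
  have hweight : ∑ e ∈ G.edgeFinset, edgeWeight F e + 2 * ∑ j, (F j).card =
      ∑ j, (F j).card * faceWeight (F j).card + 4 * G.edgeFinset.card := by
    have h1 : ∑ e ∈ G.edgeFinset, ∑ j with e ∈ F j, faceWeight (F j).card =
        ∑ j, (F j).card * faceWeight (F j).card := by
      rw [Finset.sum_comm' (t' := Finset.univ) (s' := F) fun e j => by simpa using hmem j e]
      simp
    rw [← h1, ← hdeg, Finset.mul_sum, ← Finset.sum_add_distrib, mul_comm 4, ← smul_eq_mul,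
      ← Finset.sum_const, ← Finset.sum_add_distrib]
    refine Finset.sum_congr rfl fun e _ => ?_
    have := h.card_filter_mem_le_two e
    rw [edgeWeight]
    omega
  have htri : 2 * (Finset.univ.filter fun t => (F t).card = 3).card ≤
      ∑ e ∈ G.edgeFinset, edgeWeight F e := by
    calc 2 * (Finset.univ.filter fun t => (F t).card = 3).card
        ≤ ∑ t with (F t).card = 3, ∑ e ∈ F t, edgeWeight F e := by
          rw [mul_comm, ← smul_eq_mul]
          exact Finset.card_nsmul_le_sum _ _ _ fun t ht =>
            h.two_le_sum_edgeWeight hι hfree (Finset.mem_filter.1 ht).2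
      _ = ∑ e ∈ G.edgeFinset, ∑ t with (F t).card = 3 ∧ e ∈ F t, edgeWeight F e :=
          Finset.sum_comm' fun t e => by
            simp only [Finset.mem_filter, Finset.mem_univ, true_and]
            have := hmem t e
            tauto
      _ ≤ ∑ e ∈ G.edgeFinset, edgeWeight F e := by
          refine Finset.sum_le_sum fun e _ => ?_
          rw [Finset.sum_const, smul_eq_mul]
          exact h.card_mul_edgeWeight_le e
  have hface : 20 * Fintype.card ι + ∑ j, (F j).card * faceWeight (F j).card ≤
      6 * ∑ j, (F j).card + 2 * (Finset.univ.filter fun t => (F t).card = 3).card := by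
    rw [Finset.card_filter, ← Finset.card_univ, mul_comm 20, ← smul_eq_mul, ← Finset.sum_const,
      ← Finset.sum_add_distrib, Finset.mul_sum, Finset.mul_sum, ← Finset.sum_add_distrib]
    refine Finset.sum_le_sum fun j _ => ?_
    have := h.three_le_card j
    rw [faceWeight]
    split_ifs <;> omega
  omega

end SimpleGraph.IsFaceSystem

/-- For every `n ≥ 5`, every planar simple graph on `n` vertices containing no copy of the
Theta graph on 5 vertices (a 5-cycle plus a chord) has at most `5(n-2)/2` edges. -/
theorem planar_turan_theta5 (n : ℕ) (hn : 5 ≤ n)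
    (V : Type*) [Fintype V] (G : SimpleGraph V) (hcard : Fintype.card V = n)
    (hplanar : G.HasPlanarEmbedding) (hfree : ¬ ContainsCopy theta5 G) :
    (G.edgeSet.ncard : ℝ) ≤ 5 * ((n : ℝ) - 2) / 2 := by
  classical
  have : Nonempty V := Fintype.card_pos_iff.1 (by omega)
  obtain ⟨T, F, h⟩ := hplanar.exists_isFaceSystem
  have hle := h.card_le
  have hnat : 2 * G.edgeSet.ncard + 10 ≤ 5 * n := by
    rcases lt_or_ge (Fintype.card T) 5 with hT | hT
    · omega
    · have := h.five_mul_card_le hT hfree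
      omega
  have hreal : (2 * G.edgeSet.ncard + 10 : ℝ) ≤ 5 * n := by exact_mod_cast hnat
  linarith
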